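/- arXiv:0801.3852 — 3 statements merged into one kernel-verified Lean document; each statement's English description precedes it below -/
import Mathlib

section
/- Let n, m ≥ 1 be integers, μ ∈ ℝ with μ < −n, and Λ ⊂ ℂ a closed sector. Let p : ℝⁿ × Λ → ℂ be measurable, and for each j ∈ ℕ₀ let p_j : (ℝⁿ × Λ) ∖ {(0,0)} → ℂ be continuous and anisotropic homogeneous of degree μ − j with anisotropy m. Assume that for every J ∈ ℕ there exist constants C_J, R_J > 0 such that |p(ζ, λ) − Σ_{j=0}^{J−1} p_j(ζ, λ)| ≤ C_J · (1 + |ζ| + |λ|^{1/m})^{μ−J} for all (ζ, λ) ∈ ℝⁿ × Λ with |ζ| + |λ|^{1/m} ≥ R_J. For ω ∈ Λ with |ω| = 1 set c_j(ω) = ∫_{ℝⁿ} p_j(ζ, ω) dζ (a finite integral since μ − j < −n). Then for all λ ∈ Λ with |λ| sufficiently large the function ζ ↦ p(ζ, λ) is integrable on ℝⁿ, and for every J ∈ ℕ one has, as |λ| → ∞ with λ ∈ Λ: ∫_{ℝⁿ} p(ζ, λ) dζ = Σ_{j=0}^{J−1} c_j(λ̂) · |λ|^{(n+μ−j)/m}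 + O(|λ|^{(n+μ−J)/m}). -/
open MeasureTheory

/-- A closed sector in the complex plane: `Λ = {r e^{iφ} : r ≥ 0, |φ − φ₀| ≤ a}`. -/
def IsClosedSector (Λ : Set ℂ) : Prop :=
  ∃ φ₀ a : ℝ, 0 < a ∧
    Λ = {z : ℂ | ∃ r φ : ℝ, 0 ≤ r ∧ |φ - φ₀| ≤ a ∧ z = r * Complex.exp (φ * Complex.I)}


section helpers

variable {n : ℕ}

lemma sector_mul {Λ : Set ℂ} (hΛ : IsClosedSector Λ) {t : ℝ} (ht : 0 ≤ t) {z : ℂ} (hz : z ∈ Λ) :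
    (t : ℂ) * z ∈ Λ := by
  obtain ⟨φ₀, a, ha, rfl⟩ := hΛ
  obtain ⟨r, φ, hr, hφ, rfl⟩ := hz
  exact ⟨t * r, φ, by positivity, hφ, by push_cast; ring⟩

lemma int_base {s : ℝ} (hs : s < -(n : ℝ)) :
    Integrable (fun x : EuclideanSpace ℝ (Fin n) => (1 + ‖x‖) ^ s) := by
  have := integrable_one_add_norm (E := EuclideanSpace ℝ (Fin n)) (μ := volume) (r := -s)
    (by rw [finrank_euclideanSpace_fin]; linarith)
  simpa using this

lemma int_hom (m : ℕ) (hm : 1 ≤ m) {s : ℝ} (hs : s < -(n : ℝ))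
    {Λ : Set ℂ} (hΛ : IsClosedSector Λ) (f : EuclideanSpace ℝ (Fin n) → ℂ → ℂ)
    (hcont : ContinuousOn (fun q : EuclideanSpace ℝ (Fin n) × ℂ => f q.1 q.2)
      ((Set.univ ×ˢ Λ) \ {(0, 0)}))
    (hhom : ∀ ϱ : ℝ, 0 < ϱ → ∀ ζ : EuclideanSpace ℝ (Fin n), ∀ z ∈ Λ,
      (ζ, z) ≠ (0, 0) →
      f (ϱ • ζ) (((ϱ ^ m : ℝ) : ℂ) * z) = ((ϱ ^ s : ℝ) : ℂ) * f ζ z)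
    {ω : ℂ} (hω : ω ∈ Λ) (hω0 : ω ≠ 0) : Integrable fun ζ => f ζ ω := by
  have hm0 : m ≠ 0 := by omega
  have hc : Continuous fun ζ => f ζ ω := by
    have : Continuous fun ζ : EuclideanSpace ℝ (Fin n) => (ζ, ω) := by fun_prop
    refine hcont.comp_continuous this (fun ζ => ⟨⟨trivial, hω⟩, ?_⟩)
    simp [hω0]
  let K : Set (EuclideanSpace ℝ (Fin n) × ℝ) :=
    (Metric.closedBall 0 1 ×ˢ Set.Icc 0 1) ∩ {q | ‖q.1‖ + q.2 = 1}
  have hK : IsCompact K := by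
    refine ((isCompact_closedBall _ _).prod isCompact_Icc).inter_right ?_
    exact isClosed_eq (by fun_prop) (by fun_prop)
  have hcK : ContinuousOn (fun q : EuclideanSpace ℝ (Fin n) × ℝ =>
      f q.1 (((q.2 ^ m : ℝ) : ℂ) * ω)) K := by
    have h1 : Continuous (fun q : EuclideanSpace ℝ (Fin n) × ℝ =>
      (q.1, ((q.2 ^ m : ℝ) : ℂ) * ω)) := by fun_prop
    refine hcont.comp h1.continuousOn ?_
    rintro ⟨η, t⟩ ⟨⟨_, ht⟩, h⟩
    refine ⟨⟨trivial, sector_mul hΛ (pow_nonneg ht.1 m) hω⟩, ?_⟩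
    intro h0
    simp only [Set.mem_singleton_iff, Prod.mk.injEq, mul_eq_zero, hω0, or_false,
      Complex.ofReal_eq_zero, pow_eq_zero_iff hm0] at h0
    simp [h0.1, h0.2] at h
  obtain ⟨B, hB⟩ := hK.exists_bound_of_continuousOn hcK
  refine ((int_base hs).mul_const B).mono' hc.aestronglyMeasurable (ae_of_all _ fun ζ => ?_)
  have hϱ : 0 < 1 + ‖ζ‖ := by positivity
  have key := hhom (1 + ‖ζ‖) hϱ ((1 + ‖ζ‖)⁻¹ • ζ) ((((1 + ‖ζ‖)⁻¹ ^ m : ℝ) : ℂ) * ω)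
    (sector_mul hΛ (by positivity) hω) (by
      intro h0
      simp only [Prod.mk.injEq, mul_eq_zero, hω0, or_false,
        Complex.ofReal_eq_zero, pow_eq_zero_iff hm0] at h0
      exact (inv_pos.2 hϱ).ne' h0.2)
  rw [smul_smul, mul_inv_cancel₀ hϱ.ne', one_smul, ← mul_assoc, ← Complex.ofReal_mul, ← mul_pow,
    mul_inv_cancel₀ hϱ.ne', one_pow, Complex.ofReal_one, one_mul] at key
  rw [key, norm_mul, Complex.norm_real, Real.norm_of_nonneg (by positivity)]
  gcongr
  refine hB ((1 + ‖ζ‖)⁻¹ • ζ, (1 + ‖ζ‖)⁻¹) ?_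
  have e1 : ‖(1 + ‖ζ‖)⁻¹ • ζ‖ = (1 + ‖ζ‖)⁻¹ * ‖ζ‖ := by
    rw [norm_smul, Real.norm_of_nonneg (by positivity)]
  have e2 : ‖(1 + ‖ζ‖)⁻¹ • ζ‖ + (1 + ‖ζ‖)⁻¹ = 1 := by
    rw [e1]; field_simp; ring
  have e3 : 0 < (1 + ‖ζ‖)⁻¹ := by positivity
  refine ⟨⟨?_, ?_, ?_⟩, e2⟩
  · simp only [mem_closedBall_zero_iff]; linarith
  · exact e3.le
  · linarith [norm_nonneg ((1 + ‖ζ‖)⁻¹ • ζ)]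

lemma integral_scale (F G : EuclideanSpace ℝ (Fin n) → ℂ) {ϱ s : ℝ} (hϱ : 0 < ϱ)
    (h : ∀ η, F (ϱ • η) = ((ϱ ^ s : ℝ) : ℂ) * G η) :
    ∫ ζ, F ζ = (∫ η, G η) * ((ϱ ^ ((n : ℝ) + s) : ℝ) : ℂ) := by
  have h1 := Measure.integral_comp_smul (volume : Measure (EuclideanSpace ℝ (Fin n))) F ϱ
  simp_rw [h] at h1
  rw [integral_const_mul, finrank_euclideanSpace_fin, abs_of_pos (by positivity)] at h1
  have h2 : (∫ ζ, F ζ) = (ϱ ^ n : ℝ) • ((ϱ ^ n)⁻¹ : ℝ) • ∫ ζ, F ζ := by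
    rw [smul_smul, mul_inv_cancel₀ (by positivity), one_smul]
  rw [h2, ← h1, Real.rpow_add hϱ, Real.rpow_natCast, Complex.real_smul]
  push_cast; ring

lemma bound_aux {s : ℝ} (hs : s < -(n : ℝ)) {ϱ : ℝ} (hϱ : 0 < ϱ) :
    Integrable (fun x : EuclideanSpace ℝ (Fin n) => (1 + ‖x‖ + ϱ) ^ s) ∧
    ∫ x : EuclideanSpace ℝ (Fin n), (1 + ‖x‖ + ϱ) ^ s ≤
      (∫ x : EuclideanSpace ℝ (Fin n), (1 + ‖x‖) ^ s) * ϱ ^ ((n : ℝ) + s) := by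
  have hs0 : s ≤ 0 := by have : (0 : ℝ) ≤ n := by positivity
                         linarith
  have i1 : Integrable (fun x : EuclideanSpace ℝ (Fin n) => (1 + ‖x‖ + ϱ) ^ s) := by
    refine (int_base hs).mono' ?_ (ae_of_all _ fun x => ?_)
    · exact (Measurable.pow_const (by fun_prop) _).aestronglyMeasurable
    · rw [Real.norm_of_nonneg (by positivity)]
      exact Real.rpow_le_rpow_of_nonpos (by positivity) (by linarith) hs0
  refine ⟨i1, ?_⟩
  have h1 := Measure.integral_comp_smul (volume : Measure (EuclideanSpace ℝ (Fin n)))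
    (fun x => (1 + ‖x‖ + ϱ) ^ s) ϱ
  rw [finrank_euclideanSpace_fin, abs_of_pos (by positivity), smul_eq_mul] at h1
  have i2 : Integrable (fun x : EuclideanSpace ℝ (Fin n) => (1 + ‖ϱ • x‖ + ϱ) ^ s) :=
    i1.comp_smul hϱ.ne'
  have h3 : ∫ x : EuclideanSpace ℝ (Fin n), (1 + ‖ϱ • x‖ + ϱ) ^ s ≤
      ∫ x : EuclideanSpace ℝ (Fin n), ϱ ^ s * (1 + ‖x‖) ^ s := by
    refine integral_mono i2 ((int_base hs).const_mul _) fun x => ?_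
    simp only
    rw [← Real.mul_rpow hϱ.le (by positivity)]
    refine Real.rpow_le_rpow_of_nonpos (by positivity) ?_ hs0
    rw [norm_smul, Real.norm_of_nonneg hϱ.le]; linarith
  rw [h1, integral_const_mul, inv_mul_le_iff₀ (by positivity)] at h3
  refine h3.trans_eq ?_
  rw [Real.rpow_add hϱ, Real.rpow_natCast]; ring

end helpers

/-- The integral over the covariables of a classical anisotropic parameter-dependent
symbol of order `μ < -n` admits a complete asymptotic expansion in the powers
`|λ|^{(n+μ-j)/m}` as `|λ| → ∞` in the sector `Λ`. -/
theorem stmt_3 (n m : ℕ) (hn : 1 ≤ n) (hm : 1 ≤ m) (μ : ℝ) (hμ : μ < -(n : ℝ))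
    (Λ : Set ℂ) (hΛ : IsClosedSector Λ)
    (p : EuclideanSpace ℝ (Fin n) → ℂ → ℂ)
    (hpmeas : Measurable (Function.uncurry p))
    (pj : ℕ → EuclideanSpace ℝ (Fin n) → ℂ → ℂ)
    (hcont : ∀ j : ℕ, ContinuousOn (fun q : EuclideanSpace ℝ (Fin n) × ℂ => pj j q.1 q.2)
      ((Set.univ ×ˢ Λ) \ {(0, 0)}))
    (hhom : ∀ j : ℕ, ∀ ϱ : ℝ, 0 < ϱ → ∀ ζ : EuclideanSpace ℝ (Fin n), ∀ z ∈ Λ,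
      (ζ, z) ≠ (0, 0) →
      pj j (ϱ • ζ) (((ϱ ^ m : ℝ) : ℂ) * z) = ((ϱ ^ (μ - (j : ℝ)) : ℝ) : ℂ) * pj j ζ z)
    (hsym : ∀ J : ℕ, 1 ≤ J → ∃ C R : ℝ, 0 < C ∧ 0 < R ∧
      ∀ ζ : EuclideanSpace ℝ (Fin n), ∀ z ∈ Λ,
        R ≤ ‖ζ‖ + ‖z‖ ^ (1 / (m : ℝ)) →
        ‖p ζ z - ∑ j ∈ Finset.range J, pj j ζ z‖ ≤
          C * (1 + ‖ζ‖ + ‖z‖ ^ (1 / (m : ℝ))) ^ (μ - (J : ℝ))) :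
    (∀ j : ℕ, ∀ ω ∈ Λ, ‖ω‖ = 1 → Integrable fun ζ => pj j ζ ω) ∧
    (∃ R₀ : ℝ, ∀ z ∈ Λ, R₀ ≤ ‖z‖ → Integrable fun ζ => p ζ z) ∧
    ∀ J : ℕ, 1 ≤ J → ∃ C R₀ : ℝ, 0 < C ∧
      ∀ z ∈ Λ, R₀ ≤ ‖z‖ →
        ‖(∫ ζ, p ζ z) - ∑ j ∈ Finset.range J,
            (∫ ζ, pj j ζ (z / ‖z‖)) *
              ((‖z‖ ^ (((n : ℝ) + μ - (j : ℝ)) / (m : ℝ)) : ℝ) : ℂ)‖ ≤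
          C * ‖z‖ ^ (((n : ℝ) + μ - (J : ℝ)) / (m : ℝ)) := by
  have hm0 : m ≠ 0 := by omega
  have hmR : (m : ℝ) ≠ 0 := by exact_mod_cast hm0
  have hlt : ∀ j : ℕ, μ - (j : ℝ) < -(n : ℝ) := fun j => by
    have : (0 : ℝ) ≤ j := by positivity
    linarith
  have hint : ∀ j : ℕ, ∀ ω ∈ Λ, ω ≠ 0 → Integrable fun ζ => pj j ζ ω := fun j ω hω h0 =>
    int_hom m hm (hlt j) hΛ (pj j) (hcont j) (hhom j) hω h0
  have hpm : ∀ z, Measurable fun ζ => p ζ z := fun z =>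
    hpmeas.comp (measurable_id.prodMk measurable_const)
  -- everything at once, for a fixed number of terms
  have main : ∀ J : ℕ, 1 ≤ J → ∃ C R₀ : ℝ, 0 < C ∧
      ∀ z ∈ Λ, R₀ ≤ ‖z‖ → (Integrable fun ζ => p ζ z) ∧
        ‖(∫ ζ, p ζ z) - ∑ j ∈ Finset.range J,
            (∫ ζ, pj j ζ (z / ‖z‖)) *
              ((‖z‖ ^ (((n : ℝ) + μ - (j : ℝ)) / (m : ℝ)) : ℝ) : ℂ)‖ ≤
          C * ‖z‖ ^ (((n : ℝ) + μ - (J : ℝ)) / (m : ℝ)) := by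
    intro J hJ
    obtain ⟨C, R, hC, hR, hb⟩ := hsym J hJ
    have hI : 0 ≤ ∫ x : EuclideanSpace ℝ (Fin n), (1 + ‖x‖) ^ (μ - (J : ℝ)) :=
      integral_nonneg fun x => by positivity
    refine ⟨C * ((∫ x : EuclideanSpace ℝ (Fin n), (1 + ‖x‖) ^ (μ - (J : ℝ))) + 1),
      max 1 (R ^ m), by positivity, fun z hz hzR => ?_⟩
    have hz1 : 1 ≤ ‖z‖ := (le_max_left _ _).trans hzR
    have hzp : 0 < ‖z‖ := by linarith
    have hz0 : z ≠ 0 := norm_pos_iff.1 hzp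
    set ϱ : ℝ := ‖z‖ ^ (1 / (m : ℝ)) with hϱdef
    have hϱ : 0 < ϱ := by positivity
    have hϱm : ϱ ^ m = ‖z‖ := by
      rw [hϱdef, ← Real.rpow_natCast, ← Real.rpow_mul hzp.le, one_div, inv_mul_cancel₀ hmR,
        Real.rpow_one]
    have hpow : ∀ s : ℝ, ‖z‖ ^ (s / (m : ℝ)) = ϱ ^ s := fun s => by
      rw [hϱdef, ← Real.rpow_mul hzp.le]; congr 1; ring
    have hRϱ : R ≤ ϱ := by
      refine le_of_pow_le_pow_left₀ hm0 hϱ.le ?_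
      rw [hϱm]; exact (le_max_right _ _).trans hzR
    have hω : z / ‖z‖ ∈ Λ := by
      have := sector_mul hΛ (inv_nonneg.2 hzp.le) hz
      rwa [Complex.ofReal_inv, mul_comm, ← div_eq_mul_inv] at this
    have hnz : (‖z‖ : ℂ) ≠ 0 := by exact_mod_cast hzp.ne'
    have hω0 : z / ‖z‖ ≠ 0 := div_ne_zero hz0 hnz
    have hsc : ∀ j : ℕ, ∫ ζ, pj j ζ z = (∫ ζ, pj j ζ (z / ‖z‖)) *
        ((‖z‖ ^ (((n : ℝ) + μ - (j : ℝ)) / (m : ℝ)) : ℝ) : ℂ) := by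
      intro j
      rw [hpow, add_sub_assoc]
      refine integral_scale (fun ζ => pj j ζ z) (fun ζ => pj j ζ (z / ‖z‖)) hϱ fun η => ?_
      have := hhom j ϱ hϱ η _ hω (by simp [hz0])
      rwa [hϱm, mul_div_cancel₀ _ hnz] at this
    have hsumI : Integrable fun ζ => ∑ j ∈ Finset.range J, pj j ζ z :=
      integrable_finsetSum _ fun j _ => hint j z hz hz0
    have hptw : ∀ ζ, ‖p ζ z - ∑ j ∈ Finset.range J, pj j ζ z‖ ≤
        C * (1 + ‖ζ‖ + ϱ) ^ (μ - (J : ℝ)) := fun ζ =>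
      hb ζ z hz (by linarith [norm_nonneg ζ])
    obtain ⟨b1, b2⟩ := bound_aux (hlt J) hϱ
    have hdI : Integrable fun ζ => p ζ z - ∑ j ∈ Finset.range J, pj j ζ z :=
      (b1.const_mul C).mono' ((hpm z).aestronglyMeasurable.sub hsumI.aestronglyMeasurable)
        (ae_of_all _ hptw)
    have hpI : Integrable fun ζ => p ζ z := by
      have := hdI.add hsumI
      refine this.congr (ae_of_all _ fun ζ => ?_)
      simp
    refine ⟨hpI, ?_⟩
    simp_rw [← hsc]
    rw [← integral_finsetSum _ fun j _ => hint j z hz hz0, ← integral_sub hpI hsumI]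
    refine (norm_integral_le_of_norm_le (b1.const_mul C) (ae_of_all _ hptw)).trans ?_
    rw [integral_const_mul, mul_assoc, hpow, add_sub_assoc]
    refine mul_le_mul_of_nonneg_left (b2.trans ?_) hC.le
    gcongr
    linarith
  refine ⟨fun j ω hω h1 => hint j ω hω (by rintro rfl; simp at h1), ?_, ?_⟩
  · obtain ⟨C, R₀, _, h⟩ := main 1 le_rfl
    exact ⟨R₀, fun z hz hR => (h z hz hR).1⟩
  · intro J hJ
    obtain ⟨C, R₀, hC, h⟩ := main J hJ
    exact ⟨C, R₀, hC, fun z hz hR => (h z hz hR).2⟩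
end

section
/- Let n, m ≥ 1 be integers, μ ∈ ℝ with μ < −n, and let Ω ⊂ ℂ ∖ {0} be an open cone (ϱλ ∈ Ω for all λ ∈ Ω and ϱ > 0). Let p : ℝⁿ × Ω → ℂ be infinitely differentiable (as a function of (ζ, Re λ, Im λ) ∈ ℝⁿ × ℝ²), satisfy p(ϱζ, ϱ^m λ) = ϱ^μ p(ζ, λ) for all ϱ > 0, and assume that for every pair of multi-indices/orders β, γ of differentiation in ζ and in (Re λ, Im λ) there is a constant C_{β,γ} with |∂_ζ^β ∂_λ^γ p(ζ, λ)| ≤ C_{β,γ} (|ζ| + |λ|^{1/m})^{μ − |β| − m|γ|} on ℝⁿ × Ω. Then F(λ) := ∫_{ℝⁿ} p(ζ, λ) dζ is well defined (the integral converges absolutely for every λ ∈ Ω), F is infinitely differentiable on Ω, and F(λ) = |λ|^{(n+μ)/m} F(λ/|λ|) for all λ ∈ Ω. -/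
open MeasureTheory

lemma stmt10_cont_left {n : ℕ} {H : Type} [NormedAddCommGroup H] [NormedSpace ℝ H]
    {Ω : Set ℂ} {G : EuclideanSpace ℝ (Fin n) → ℂ → H}
    (hG : ContDiffOn ℝ (⊤ : ℕ∞)
      (fun q : EuclideanSpace ℝ (Fin n) × ℂ => G q.1 q.2) (Set.univ ×ˢ Ω))
    {z : ℂ} (hz : z ∈ Ω) : Continuous fun ζ => G ζ z := by
  have h1 : ContinuousOn ((fun q : EuclideanSpace ℝ (Fin n) × ℂ => G q.1 q.2) ∘ fun ζ => (ζ, z))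
      Set.univ :=
    hG.continuousOn.comp (by fun_prop) (fun ζ _ => ⟨Set.mem_univ _, hz⟩)
  exact continuousOn_univ.1 h1

lemma stmt10_aux {n : ℕ} {Ω : Set ℂ} (hopen : IsOpen Ω) (k : ℕ) :
    ∀ (H : Type) [NormedAddCommGroup H] [NormedSpace ℝ H]
      (G : EuclideanSpace ℝ (Fin n) → ℂ → H)
      (_ : ContDiffOn ℝ (⊤ : ℕ∞)
        (fun q : EuclideanSpace ℝ (Fin n) × ℂ => G q.1 q.2) (Set.univ ×ˢ Ω))
      (_ : ∀ l : ℕ, ∀ z₀ ∈ Ω, ∃ s ∈ nhds z₀, ∃ b : EuclideanSpace ℝ (Fin n) → ℝ,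
        Integrable b ∧ ∀ ζ, ∀ z ∈ s, z ∈ Ω → ‖iteratedFDerivWithin ℝ l (G ζ) Ω z‖ ≤ b ζ),
      ContDiffOn ℝ k (fun z => ∫ ζ, G ζ z) Ω := by
  have key : ∀ (H : Type) [NormedAddCommGroup H] [NormedSpace ℝ H]
      (G : EuclideanSpace ℝ (Fin n) → ℂ → H)
      (_ : ContDiffOn ℝ (⊤ : ℕ∞)
        (fun q : EuclideanSpace ℝ (Fin n) × ℂ => G q.1 q.2) (Set.univ ×ˢ Ω))
      (_ : ∀ l : ℕ, ∀ z₀ ∈ Ω, ∃ s ∈ nhds z₀, ∃ b : EuclideanSpace ℝ (Fin n) → ℝ,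
        Integrable b ∧ ∀ ζ, ∀ z ∈ s, z ∈ Ω → ‖iteratedFDerivWithin ℝ l (G ζ) Ω z‖ ≤ b ζ),
      ∃ G' : EuclideanSpace ℝ (Fin n) → ℂ → (ℂ →L[ℝ] H),
        ContDiffOn ℝ (⊤ : ℕ∞)
          (fun q : EuclideanSpace ℝ (Fin n) × ℂ => G' q.1 q.2) (Set.univ ×ˢ Ω) ∧
        (∀ l : ℕ, ∀ z₀ ∈ Ω, ∃ s ∈ nhds z₀, ∃ b : EuclideanSpace ℝ (Fin n) → ℝ,
          Integrable b ∧ ∀ ζ, ∀ z ∈ s, z ∈ Ω → ‖iteratedFDerivWithin ℝ l (G' ζ) Ω z‖ ≤ b ζ) ∧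
        ∀ z ∈ Ω, HasFDerivAt (fun z => ∫ ζ, G ζ z) (∫ ζ, G' ζ z) z := by
    intro H _ _ G hG hb
    have hprod : IsOpen ((Set.univ : Set (EuclideanSpace ℝ (Fin n))) ×ˢ Ω) :=
      isOpen_univ.prod hopen
    let G' : EuclideanSpace ℝ (Fin n) → ℂ → (ℂ →L[ℝ] H) := fun ζ z =>
      (fderiv ℝ (fun q : EuclideanSpace ℝ (Fin n) × ℂ => G q.1 q.2) (ζ, z)).comp
        (ContinuousLinearMap.inr ℝ (EuclideanSpace ℝ (Fin n)) ℂ)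
    have hG's : ContDiffOn ℝ (⊤ : ℕ∞)
          (fun q : EuclideanSpace ℝ (Fin n) × ℂ => G' q.1 q.2) (Set.univ ×ˢ Ω) := by
      have h1 := hG.fderiv_of_isOpen (m := (⊤ : ℕ∞)) hprod (by simp)
      exact h1.clm_comp contDiffOn_const
    have hder : ∀ ζ, ∀ z ∈ Ω, HasFDerivAt (G ζ) (G' ζ z) z := by
      intro ζ z hz
      have h1 : DifferentiableAt ℝ (fun q : EuclideanSpace ℝ (Fin n) × ℂ => G q.1 q.2) (ζ, z) :=
        (hG.differentiableOn (by simp)).differentiableAt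
          (hprod.mem_nhds ⟨Set.mem_univ _, hz⟩)
      exact h1.hasFDerivAt.comp z (hasFDerivAt_prodMk_right ζ z)
    have hnorm : ∀ l : ℕ, ∀ ζ, ∀ z ∈ Ω, ‖iteratedFDerivWithin ℝ l (G' ζ) Ω z‖ =
        ‖iteratedFDerivWithin ℝ (l + 1) (G ζ) Ω z‖ := by
      intro l ζ z hz
      rw [← norm_iteratedFDerivWithin_fderivWithin hopen.uniqueDiffOn hz]
      congr 1
      refine iteratedFDerivWithin_congr (fun y hy => ?_) hz l
      rw [fderivWithin_of_isOpen hopen hy, (hder ζ y hy).fderiv]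
    refine ⟨G', hG's, ?_, ?_⟩
    · intro l z₀ hz₀
      obtain ⟨s, hs, b, hbi, hbb⟩ := hb (l + 1) z₀ hz₀
      exact ⟨s, hs, b, hbi, fun ζ z hz hzΩ => (hnorm l ζ z hzΩ).trans_le (hbb ζ z hz hzΩ)⟩
    · intro z₀ hz₀
      obtain ⟨s, hs, b, hbi, hbb⟩ := hb 1 z₀ hz₀
      obtain ⟨s0, hs0, b0, hbi0, hbb0⟩ := hb 0 z₀ hz₀
      have hΩ := hopen.mem_nhds hz₀
      refine hasFDerivAt_integral_of_dominated_of_fderiv_le (F := fun z ζ => G ζ z)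
        (F' := fun z ζ => G' ζ z) (s := s ∩ Ω) (bound := b) (Filter.inter_mem hs hΩ) ?_ ?_ ?_ ?_ hbi ?_
      · filter_upwards [hΩ] with z hz
        exact (stmt10_cont_left hG hz).aestronglyMeasurable
      · refine hbi0.mono' (stmt10_cont_left hG hz₀).aestronglyMeasurable
          (Filter.Eventually.of_forall fun ζ => ?_)
        simpa using hbb0 ζ z₀ (mem_of_mem_nhds hs0) hz₀
      · exact (stmt10_cont_left hG's hz₀).aestronglyMeasurable
      · refine Filter.Eventually.of_forall fun ζ z hz => ?_
        have := (hnorm 0 ζ z hz.2).trans_le (hbb ζ z hz.1 hz.2)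
        simpa using this
      · exact Filter.Eventually.of_forall fun ζ z hz => hder ζ z hz.2
  induction k with
  | zero =>
    intro H _ _ G hG hb
    obtain ⟨G', _, _, h3⟩ := key H G hG hb
    rw [Nat.cast_zero, contDiffOn_zero]
    exact fun z hz => (h3 z hz).continuousAt.continuousWithinAt
  | succ k ih =>
    intro H _ _ G hG hb
    obtain ⟨G', h1, h2, h3⟩ := key H G hG hb
    rw [Nat.cast_succ, contDiffOn_succ_iff_fderiv_of_isOpen hopen]
    refine ⟨fun z hz => (h3 z hz).differentiableAt.differentiableWithinAt, by simp, ?_⟩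
    exact (ih _ G' h1 h2).congr fun z hz => (h3 z hz).fderiv

lemma stmt10_bound {n m : ℕ} (hm : 1 ≤ m) {μ : ℝ} (hμ : μ < -(n : ℝ)) (l : ℕ) (C r : ℝ) (hC : 0 < C)
    (hr : 0 < r) : ∃ b : EuclideanSpace ℝ (Fin n) → ℝ, Integrable b ∧
      ∀ ζ : EuclideanSpace ℝ (Fin n), ∀ z : ℂ, r ≤ ‖z‖ →
      C * (‖ζ‖ + ‖z‖ ^ (1 / (m : ℝ))) ^ (μ - ((0 : ℕ) : ℝ) - (m : ℝ) * (l : ℝ)) ≤ b ζ := by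
  set s : ℝ := μ - ((0 : ℕ) : ℝ) - (m : ℝ) * (l : ℝ) with hs
  have hsn : s < -(n : ℝ) := by
    have : (0 : ℝ) ≤ (m : ℝ) * l := by positivity
    simp only [Nat.cast_zero, sub_zero] at hs
    linarith
  have hs0 : s ≤ 0 := by
    have : (0 : ℝ) ≤ n := by positivity
    linarith
  set d : ℝ := min (r ^ (1 / (m : ℝ))) 1 with hd
  have hdpos : 0 < d := lt_min (Real.rpow_pos_of_pos hr _) one_pos
  refine ⟨fun ζ => C * (d ^ s * (1 + ‖ζ‖) ^ (- (-s))), ?_, ?_⟩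
  · refine ((integrable_one_add_norm ?_).const_mul _).const_mul _
    simp only [finrank_euclideanSpace, Fintype.card_fin]
    linarith
  · intro ζ z hz
    simp only [neg_neg]
    rw [← Real.mul_rpow hdpos.le (by positivity)]
    refine mul_le_mul_of_nonneg_left ?_ hC.le
    refine Real.rpow_le_rpow_of_nonpos (by positivity) ?_ hs0
    have h1 : d ≤ ‖z‖ ^ (1 / (m : ℝ)) :=
      (min_le_left _ _).trans (Real.rpow_le_rpow hr.le hz (by positivity))
    have h2 : d ≤ 1 := min_le_right _ _
    nlinarith [norm_nonneg ζ]

/-- For an anisotropic homogeneous symbol `p` of degree `μ < -n` with anisotropy `m`,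
smooth on `ℝⁿ × Ω` for an open cone `Ω ⊂ ℂ ∖ {0}` and satisfying the anisotropic
symbol estimates, the integral `F(λ) = ∫ p(ζ,λ) dζ` converges absolutely, is smooth
in `λ`, and satisfies `F(λ) = |λ|^{(n+μ)/m} F(λ/|λ|)`. -/
theorem stmt_10 (n m : ℕ) (hn : 1 ≤ n) (hm : 1 ≤ m) (μ : ℝ) (hμ : μ < -(n : ℝ))
    (Ω : Set ℂ) (hopen : IsOpen Ω) (h0 : (0 : ℂ) ∉ Ω)
    (hcone : ∀ z ∈ Ω, ∀ ϱ : ℝ, 0 < ϱ → (ϱ : ℂ) * z ∈ Ω)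
    (p : EuclideanSpace ℝ (Fin n) → ℂ → ℂ)
    (hsmooth : ContDiffOn ℝ (⊤ : ℕ∞)
      (fun q : EuclideanSpace ℝ (Fin n) × ℂ => p q.1 q.2) (Set.univ ×ˢ Ω))
    (hhom : ∀ ϱ : ℝ, 0 < ϱ → ∀ ζ : EuclideanSpace ℝ (Fin n), ∀ z ∈ Ω,
      p (ϱ • ζ) (((ϱ ^ m : ℝ) : ℂ) * z) = ((ϱ ^ μ : ℝ) : ℂ) * p ζ z)
    (hbound : ∀ j l : ℕ, ∃ Cb : ℝ, 0 < Cb ∧ ∀ ζ : EuclideanSpace ℝ (Fin n), ∀ z ∈ Ω,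
      ‖iteratedFDerivWithin ℝ l
          (fun w : ℂ => iteratedFDeriv ℝ j (fun ξ => p ξ w) ζ) Ω z‖ ≤
        Cb * (‖ζ‖ + ‖z‖ ^ (1 / (m : ℝ))) ^ (μ - (j : ℝ) - (m : ℝ) * (l : ℝ))) :
    (∀ z ∈ Ω, Integrable fun ζ => p ζ z) ∧
    ContDiffOn ℝ (⊤ : ℕ∞) (fun z => ∫ ζ, p ζ z) Ω ∧
    ∀ z ∈ Ω, (∫ ζ, p ζ z) =
      ((‖z‖ ^ (((n : ℝ) + μ) / (m : ℝ)) : ℝ) : ℂ) *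
        ∫ ζ, p ζ (z / ‖z‖) := by
  have hb : ∀ l : ℕ, ∀ z₀ ∈ Ω, ∃ s ∈ nhds z₀, ∃ b : EuclideanSpace ℝ (Fin n) → ℝ,
      Integrable b ∧ ∀ ζ, ∀ z ∈ s, z ∈ Ω → ‖iteratedFDerivWithin ℝ l (p ζ) Ω z‖ ≤ b ζ := by
    intro l z₀ hz₀
    have hz0 : 0 < ‖z₀‖ := norm_pos_iff.2 fun h => h0 (h ▸ hz₀)
    obtain ⟨C, hC, hCb⟩ := hbound 0 l
    obtain ⟨b, hbi, hbb⟩ := stmt10_bound (n := n) hm hμ l C (‖z₀‖ / 2) hC (by positivity)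
    refine ⟨{z | ‖z₀‖ / 2 < ‖z‖}, ?_, b, hbi, ?_⟩
    · exact (isOpen_lt continuous_const continuous_norm).mem_nhds (half_lt_self hz0)
    · intro ζ z hz hzΩ
      refine le_trans ?_ ((hCb ζ z hzΩ).trans (hbb ζ z (le_of_lt hz)))
      exact (LinearIsometryEquiv.norm_iteratedFDerivWithin_comp_left
        (continuousMultilinearCurryFin0 ℝ (EuclideanSpace ℝ (Fin n)) ℂ).symm (p ζ)
        hopen.uniqueDiffOn hzΩ l).symm.le
  refine ⟨?_, ?_, ?_⟩
  · intro z hz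
    obtain ⟨s, hs, b, hbi, hbb⟩ := hb 0 z hz
    refine hbi.mono' (stmt10_cont_left hsmooth hz).aestronglyMeasurable
      (Filter.Eventually.of_forall fun ζ => ?_)
    simpa using hbb ζ z (mem_of_mem_nhds hs) hz
  · rw [contDiffOn_infty]
    exact fun k => stmt10_aux hopen k ℂ p hsmooth hb
  · intro z hz
    have hz0 : 0 < ‖z‖ := norm_pos_iff.2 fun h => h0 (h ▸ hz)
    have hmR : (m : ℝ) ≠ 0 := by positivity
    set R : ℝ := ‖z‖ ^ (1 / (m : ℝ)) with hR
    have hRpos : 0 < R := Real.rpow_pos_of_pos hz0 _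
    have hRm : R ^ m = ‖z‖ := by
      rw [hR, ← Real.rpow_natCast, ← Real.rpow_mul hz0.le, one_div_mul_cancel hmR, Real.rpow_one]
    have hzC : (‖z‖ : ℂ) ≠ 0 := by exact_mod_cast hz0.ne'
    have hw : z / ‖z‖ ∈ Ω := by
      have := hcone z hz ‖z‖⁻¹ (by positivity)
      rwa [Complex.ofReal_inv, inv_mul_eq_div] at this
    have h1 : ∀ ζ, p (R • ζ) z = ((R ^ μ : ℝ) : ℂ) * p ζ (z / ‖z‖) := by
      intro ζ
      have := hhom R hRpos ζ _ hw
      rwa [hRm, mul_div_cancel₀ _ hzC] at this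
    have h2 := Measure.integral_comp_smul (volume : Measure (EuclideanSpace ℝ (Fin n)))
      (fun ζ => p ζ z) R
    simp only [h1, finrank_euclideanSpace, Fintype.card_fin] at h2
    rw [integral_const_mul, abs_of_pos (by positivity), Complex.real_smul] at h2
    have hpow : ‖z‖ ^ (((n : ℝ) + μ) / (m : ℝ)) = R ^ n * R ^ μ := by
      rw [← Real.rpow_natCast, ← Real.rpow_add hRpos, hR, ← Real.rpow_mul hz0.le]
      congr 1
      ring
    have hRn : ((R ^ n : ℝ) : ℂ) ≠ 0 := by exact_mod_cast (pow_pos hRpos n).ne'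
    rw [hpow, Complex.ofReal_mul, mul_assoc, h2, Complex.ofReal_inv, mul_inv_cancel_left₀ hRn]
end

section
/- Let δ ∈ (0, π/2), and let Ω_δ = {0} ∪ {λ ∈ ℂ ∖ {0} : |Arg λ| ≥ δ} (Arg the principal argument). Let n, m ≥ 1 be integers and N ∈ ℝ with N > n/m. Let F : Ω_δ → ℂ be continuous and holomorphic on the interior of Ω_δ, let c_j (j ∈ ℕ₀) be continuous functions on {ω ∈ ℂ : |ω| = 1, |Arg ω| ≥ δ}, and assume that for every J ∈ ℕ, F(λ) = Σ_{j=0}^{J−1} c_j(λ̂) |λ|^{(n−j)/m − N} + O(|λ|^{(n−J)/m − N}) as |λ| → ∞ in Ω_δ. For t > 0 define G(t) = (1/(2πi)) ( ∫₀^∞ e^{−t r e^{iδ}} F(r e^{iδ}) e^{iδ} dr − ∫₀^∞ e^{−t r e^{−iδ}} F(r e^{−iδ}) e^{−iδ} dr ). Then both integrals converge absolutely for every t > 0, and G admits a complete asymptotic expansion as t → 0⁺ in the powers E = {(j−n)/m + N − 1 : j ∈ ℕ₀} ∪ ℕ₀: there exist complex coefficients (α_e)_{e ∈ E} such that for every L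 ∈ ℝ, G(t) = Σ_{e ∈ E, e < L} α_e t^{e} + O(t^{L}) as t → 0⁺. -/
open MeasureTheory
open Filter Topology Asymptotics

/-- real power as a complex valued function -/
noncomputable def pw (e : ℝ) : ℝ → ℂ := fun t => ((t ^ e : ℝ) : ℂ)

/-- functions that are O(t^L) as t → 0+ -/
def OL (L : ℝ) : Submodule ℂ (ℝ → ℂ) where
  carrier := {f | f =O[𝓝[>] (0 : ℝ)] fun t : ℝ => t ^ L}
  zero_mem' := isBigO_zero _ _
  add_mem' := fun ha hb => IsBigO.add ha hb
  smul_mem' := fun c _ hf => IsBigO.const_smul_left hf c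

noncomputable def ML (E : Set ℝ) (L : ℝ) : Submodule ℂ (ℝ → ℂ) :=
  Submodule.span ℂ (pw '' E) ⊔ OL L

lemma pw_mem {E : Set ℝ} {L e : ℝ} (he : e ∈ E) : pw e ∈ ML E L :=
  Submodule.mem_sup_left (Submodule.subset_span ⟨e, he, rfl⟩)

lemma OL_mem {E : Set ℝ} {L : ℝ} {f : ℝ → ℂ} (C T : ℝ) (hT : 0 < T)
    (h : ∀ t, 0 < t → t < T → ‖f t‖ ≤ C * t ^ L) : f ∈ ML E L := by
  apply Submodule.mem_sup_right
  change f =O[𝓝[>] (0 : ℝ)] fun t : ℝ => t ^ L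
  apply IsBigO.of_bound C
  filter_upwards [Ioo_mem_nhdsGT hT] with t ht
  refine (h t ht.1 ht.2).trans (le_of_eq ?_)
  rw [Real.norm_of_nonneg (Real.rpow_nonneg ht.1.le _)]

lemma ML_congr {E : Set ℝ} {L : ℝ} {f g : ℝ → ℂ} (T : ℝ) (hT : 0 < T)
    (h : ∀ t, 0 < t → t < T → f t = g t) (hg : g ∈ ML E L) : f ∈ ML E L := by
  have : f - g ∈ ML E L := OL_mem 0 T hT (fun t h0 h1 => by simp [h t h0 h1])
  simpa using Submodule.add_mem _ this hg

lemma pw_OL {e L : ℝ} (h : L ≤ e) : pw e ∈ OL L := by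
  change pw e =O[𝓝[>] (0 : ℝ)] fun t : ℝ => t ^ L
  apply IsBigO.of_bound 1
  filter_upwards [Ioo_mem_nhdsGT (zero_lt_one' ℝ)] with t ht
  simp only [pw, Complex.norm_real, one_mul]
  rw [Real.norm_of_nonneg (Real.rpow_nonneg ht.1.le _), Real.norm_of_nonneg (Real.rpow_nonneg ht.1.le _)]
  exact Real.rpow_le_rpow_of_exponent_ge ht.1 ht.2.le h

lemma OL_mono {L L' : ℝ} (h : L ≤ L') {f : ℝ → ℂ} (hf : f ∈ OL L') : f ∈ OL L := by
  change f =O[𝓝[>] (0 : ℝ)] fun t : ℝ => t ^ L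
  refine IsBigO.trans hf ?_
  apply IsBigO.of_bound 1
  filter_upwards [Ioo_mem_nhdsGT (zero_lt_one' ℝ)] with t ht
  rw [one_mul, Real.norm_of_nonneg (Real.rpow_nonneg ht.1.le _), Real.norm_of_nonneg (Real.rpow_nonneg ht.1.le _)]
  exact Real.rpow_le_rpow_of_exponent_ge ht.1 ht.2.le h

lemma lc_unique (l : ℝ →₀ ℂ) (L : ℝ) (h : Finsupp.linearCombination ℂ pw l ∈ OL L) :
    ∀ e < L, l e = 0 := by
  by_contra! hcon
  obtain ⟨e1, he1, hne⟩ := hcon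
  have hne' : l.support.Nonempty := ⟨e1, by simpa using hne⟩
  obtain ⟨e0, he0, hmin⟩ := l.support.exists_min_image id hne'
  have he0L : e0 < L := lt_of_le_of_lt (hmin e1 (by simpa using hne)) he1
  have t1 : Tendsto (fun t : ℝ => ∑ e ∈ l.support, l e * ((t ^ (e - e0) : ℝ) : ℂ)) (𝓝[>] 0)
      (𝓝 (∑ e ∈ l.support, l e * (if e = e0 then 1 else 0))) := by
    apply tendsto_finsetSum
    intro e he
    apply Tendsto.const_mul
    split_ifs with hh
    · subst hh; simp
    · have hlt : 0 < e - e0 := sub_pos.2 (lt_of_le_of_ne (hmin e he) (Ne.symm hh))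
      have : Tendsto (fun t : ℝ => t ^ (e - e0)) (𝓝[>] 0) (𝓝 0) := by
        have := (Real.continuousAt_rpow_const 0 (e - e0) (Or.inr hlt.le)).tendsto
        rw [Real.zero_rpow hlt.ne'] at this
        exact this.mono_left nhdsWithin_le_nhds
      exact (Complex.continuous_ofReal.tendsto' 0 0 (by simp)).comp this
  have t2 : Tendsto (fun t : ℝ => ∑ e ∈ l.support, l e * ((t ^ (e - e0) : ℝ) : ℂ)) (𝓝[>] 0)
      (𝓝 0) := by
    have hlt : 0 < L - e0 := sub_pos.2 he0L
    have t3 : Tendsto (fun t : ℝ => t ^ (L - e0)) (𝓝[>] 0) (𝓝 0) := by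
      have := (Real.continuousAt_rpow_const 0 (L - e0) (Or.inr hlt.le)).tendsto
      rw [Real.zero_rpow hlt.ne'] at this
      exact this.mono_left nhdsWithin_le_nhds
    refine IsBigO.trans_tendsto ?_ t3
    have h' : (Finsupp.linearCombination ℂ pw l) =O[𝓝[>] (0 : ℝ)] fun t : ℝ => t ^ L := h
    obtain ⟨C, hC⟩ := h'.bound
    apply IsBigO.of_bound C
    filter_upwards [hC, self_mem_nhdsWithin] with t ht ht0
    have ht0' : (0:ℝ) < t := ht0
    have e1 : (∑ e ∈ l.support, l e * ((t ^ (e - e0) : ℝ) : ℂ)) =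
        (Finsupp.linearCombination ℂ pw l) t * ((t ^ (-e0) : ℝ) : ℂ) := by
      rw [Finsupp.linearCombination_apply, Finsupp.sum, Finset.sum_apply, Finset.sum_mul]
      refine Finset.sum_congr rfl fun e _ => ?_
      simp only [pw, Pi.smul_apply, smul_eq_mul]
      rw [mul_assoc, ← Complex.ofReal_mul, ← Real.rpow_add ht0', sub_eq_add_neg]
    rw [e1, norm_mul]
    have e2 : ‖t ^ (L - e0)‖ = ‖t ^ L‖ * ‖(((t ^ (-e0) : ℝ)) : ℂ)‖ := by
      rw [Complex.norm_real, ← norm_mul, ← Real.rpow_add ht0', sub_eq_add_neg]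
    rw [e2, ← mul_assoc]
    gcongr
  have := tendsto_nhds_unique t1 t2
  simp only [mul_ite, mul_one, mul_zero, Finset.sum_ite_eq', he0, if_true] at this
  simp [this] at he0

lemma exists_alpha {E : Set ℝ} {G : ℝ → ℂ} (hG : ∀ L, G ∈ ML E L) :
    ∃ α : ℝ → ℂ, (∀ e, e ∉ E → α e = 0) ∧
      ∀ L : ℝ, ∃ C T : ℝ, 0 < C ∧ 0 < T ∧ ∀ t : ℝ, 0 < t → t ≤ T →
        ‖G t - ∑ᶠ e ∈ {e : ℝ | e ∈ E ∧ e < L}, α e * ((t ^ e : ℝ) : ℂ)‖ ≤ C * t ^ L := by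
  have key : ∀ L, ∃ l : ℝ →₀ ℂ, (∀ e, e ∉ E → l e = 0) ∧
      G - Finsupp.linearCombination ℂ pw l ∈ OL L := by
    intro L
    obtain ⟨y, hy, z, hz, hyz⟩ := Submodule.mem_sup.1 (hG L)
    obtain ⟨l, hl, rfl⟩ := (Finsupp.mem_span_image_iff_linearCombination ℂ).1 hy
    refine ⟨l, fun e he => ?_, ?_⟩
    · by_contra hne
      exact he ((Finsupp.mem_supported ℂ l).1 hl (by simpa using hne))
    · rw [← hyz]; simpa using hz
  choose l hlE hl using key
  have coh : ∀ L L' e, e < L → e < L' → l L e = l L' e := by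
    intro L L' e h1 h2
    have : Finsupp.linearCombination ℂ pw (l L - l L') ∈ OL (min L L') := by
      have a := OL_mono (min_le_left L L') (hl L)
      have b := OL_mono (min_le_right L L') (hl L')
      have := Submodule.sub_mem _ b a
      simpa using this
    have := lc_unique _ _ this e (lt_min h1 h2)
    simpa [sub_eq_zero] using this
  refine ⟨fun e => l (e + 1) e, fun e he => hlE _ e he, fun L => ?_⟩
  have hs : ∀ t : ℝ, ∑ᶠ e ∈ {e : ℝ | e ∈ E ∧ e < L}, l (e + 1) e * ((t ^ e : ℝ) : ℂ) =
      ∑ e ∈ (l L).support.filter (· < L), l L e * ((t ^ e : ℝ) : ℂ) := by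
    intro t
    rw [finsum_mem_congr (g := fun e => l L e * ((t ^ e : ℝ) : ℂ)) rfl
      (fun e he => by rw [coh (e + 1) L e (by linarith) he.2])]
    apply finsum_mem_eq_sum_of_inter_support_eq
    ext e
    simp only [Set.mem_inter_iff, Set.mem_ofPred_eq, Function.mem_support, Finset.coe_filter,
      Finsupp.mem_support_iff]
    constructor
    · rintro ⟨⟨h1, h2⟩, h3⟩
      exact ⟨⟨left_ne_zero_of_mul h3, h2⟩, h3⟩
    · rintro ⟨⟨h1, h2⟩, h3⟩
      refine ⟨⟨?_, h2⟩, h3⟩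
      by_contra hne
      exact h1 (hlE L e hne)
  have hO : (fun t => G t - ∑ e ∈ (l L).support.filter (· < L), l L e * ((t ^ e : ℝ) : ℂ)) ∈ OL L := by
    have h2 : (∑ e ∈ (l L).support.filter (¬ · < L), l L e • pw e) ∈ OL L := by
      refine Submodule.sum_mem _ fun e he => Submodule.smul_mem _ _ (pw_OL ?_)
      simpa using (Finset.mem_filter.1 he).2
    convert Submodule.add_mem _ (hl L) h2 using 1
    rw [Finsupp.linearCombination_apply, Finsupp.sum,
      ← Finset.sum_filter_add_sum_filter_not (l L).support (· < L)]
    funext t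
    simp [pw, Finset.sum_apply]
    ring
  obtain ⟨C, hC0, hC⟩ := IsBigO.exists_pos hO
  rw [isBigOWith_iff] at hC
  obtain ⟨T, hT, hsub⟩ := mem_nhdsGT_iff_exists_Ioc_subset.1 hC
  refine ⟨C, T, hC0, hT, fun t h0 h1 => ?_⟩
  have := hsub ⟨h0, h1⟩
  simp only [Set.mem_ofPred_eq] at this
  rw [Real.norm_of_nonneg (Real.rpow_nonneg h0.le _)] at this
  rw [hs]
  exact this

lemma taylor_bound (K : ℕ) : ∃ C : ℝ, 0 < C ∧ ∀ z : ℂ, 0 ≤ z.re →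
    ‖Complex.exp (-z) - ∑ k ∈ Finset.range K, (-z) ^ k / (k.factorial : ℂ)‖ ≤ C * ‖z‖ ^ K := by
  refine ⟨Real.exp 1 + (1 + K), by positivity, fun z hz => ?_⟩
  rcases le_total ‖z‖ 1 with h | h
  · have := Complex.norm_exp_sub_sum_le_norm_mul_exp (-z) K
    rw [norm_neg] at this
    refine this.trans ?_
    rw [mul_comm]
    gcongr
    have : Real.exp ‖z‖ ≤ Real.exp 1 := Real.exp_le_exp.2 h
    have : (0:ℝ) ≤ K := by positivity
    linarith
  · have h1 : ‖Complex.exp (-z)‖ ≤ 1 := by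
      rw [Complex.norm_exp]; simpa using hz
    have h2 : ‖∑ k ∈ Finset.range K, (-z) ^ k / (k.factorial : ℂ)‖ ≤ K * ‖z‖ ^ K := by
      refine (norm_sum_le _ _).trans ?_
      refine (Finset.sum_le_card_nsmul _ _ (‖z‖ ^ K) fun k hk => ?_).trans (by simp)
      rw [norm_div, norm_pow, norm_neg, Complex.norm_natCast]
      have hf : (1:ℝ) ≤ k.factorial := by exact_mod_cast Nat.succ_le_of_lt k.factorial_pos
      refine (div_le_self (by positivity) hf).trans ?_
      exact pow_le_pow_right₀ h (Finset.mem_range.1 hk).le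
    have h3 : (1:ℝ) ≤ ‖z‖ ^ K := one_le_pow₀ h
    have h4 : 0 ≤ Real.exp 1 * ‖z‖ ^ K := by positivity
    refine (norm_sub_le _ _).trans ?_
    nlinarith

lemma moment_mem {E : Set ℝ} (hE : ∀ k : ℕ, (k : ℝ) ∈ E) (L : ℝ) (w : ℂ) (hw : 0 < w.re)
    (S : Set ℝ) (hS : MeasurableSet S) (hS0 : S ⊆ Set.Ioi 0) (g : ℝ → ℂ) (K : ℕ) (hK : L ≤ K)
    (hg : ∀ k : ℕ, k ≤ K → IntegrableOn (fun r : ℝ => (r : ℂ) ^ k * g r) S) :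
    (fun t : ℝ => ∫ r in S, Complex.exp (-(t : ℂ) * (r : ℂ) * w) * g r) ∈ ML E L := by
  obtain ⟨C, hC, hb⟩ := taylor_bound K
  have hg0 : IntegrableOn g S := by simpa using hg 0 (Nat.zero_le _)
  set p : ℝ → ℂ := ∑ k ∈ Finset.range K,
    ((-w) ^ k / (k.factorial : ℂ) * ∫ r in S, (r : ℂ) ^ k * g r) • pw k with hp
  have hpm : p ∈ ML E L := Submodule.sum_mem _ fun k _ => Submodule.smul_mem _ _ (pw_mem (hE k))
  have hrest : (fun t : ℝ => (∫ r in S, Complex.exp (-(t : ℂ) * (r : ℂ) * w) * g r)) - p ∈ ML E L := by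
    refine OL_mem (C * ‖w‖ ^ K * ∫ r in S, ‖(r : ℂ) ^ K * g r‖) 1 one_pos fun t h0 h1 => ?_
    have hpt : p t = ∫ r in S, (∑ k ∈ Finset.range K, (-((t : ℂ) * r * w)) ^ k / (k.factorial : ℂ)) * g r := by
      simp_rw [Finset.sum_mul]
      rw [integral_finsetSum]
      · rw [hp, Finset.sum_apply]
        refine Finset.sum_congr rfl fun k _ => ?_
        simp only [Pi.smul_apply, smul_eq_mul, pw, Real.rpow_natCast]
        rw [mul_right_comm, ← integral_const_mul]
        congr 1; funext r
        push_cast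
        rw [neg_pow w, neg_pow ((t:ℂ) * r * w), mul_pow, mul_pow]
        ring
      · intro k hk
        have := (hg k (Finset.mem_range.1 hk).le).const_mul ((-((t : ℂ) * w)) ^ k / (k.factorial : ℂ))
        refine this.congr (ae_of_all _ fun r => ?_)
        simp only
        rw [neg_pow ((t:ℂ) * w), neg_pow ((t:ℂ) * r * w), mul_pow, mul_pow, mul_pow]
        ring
    have hi1 : IntegrableOn (fun r : ℝ => Complex.exp (-(t : ℂ) * (r : ℂ) * w) * g r) S := by
      refine Integrable.bdd_mul (c := 1) hg0 ?_ ?_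
      · exact (by fun_prop : Continuous fun r : ℝ => Complex.exp (-(t : ℂ) * (r : ℂ) * w)).aestronglyMeasurable
      · refine (ae_restrict_iff' hS).2 (ae_of_all _ fun r hr => ?_)
        have hr0 : (0:ℝ) < r := hS0 hr
        rw [Complex.norm_exp]
        have : (-(t:ℂ) * r * w).re = -(t * r * w.re) := by simp [Complex.mul_re]
        rw [this]
        simp only [Real.exp_le_one_iff]
        have : 0 < t * r * w.re := by positivity
        linarith
    have hi2 : IntegrableOn (fun r : ℝ => (∑ k ∈ Finset.range K, (-((t : ℂ) * r * w)) ^ k / (k.factorial : ℂ)) * g r) S := by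
      simp_rw [Finset.sum_mul]
      refine integrable_finsetSum _ fun k hk => ?_
      have := (hg k (Finset.mem_range.1 hk).le).const_mul ((-((t : ℂ) * w)) ^ k / (k.factorial : ℂ))
      refine this.congr (ae_of_all _ fun r => ?_)
      simp only
      rw [neg_pow ((t:ℂ) * w), neg_pow ((t:ℂ) * r * w), mul_pow, mul_pow, mul_pow]
      ring
    rw [Pi.sub_apply, hpt, ← integral_sub hi1 hi2]
    have : ‖∫ r in S, (Complex.exp (-(t : ℂ) * (r : ℂ) * w) * g r - (∑ k ∈ Finset.range K, (-((t : ℂ) * r * w)) ^ k / (k.factorial : ℂ)) * g r)‖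
        ≤ ∫ r in S, C * ‖w‖ ^ K * t ^ K * ‖(r : ℂ) ^ K * g r‖ := by
      refine norm_integral_le_of_norm_le ((hg K le_rfl).norm.const_mul _) ?_
      refine (ae_restrict_iff' hS).2 (ae_of_all _ fun r hr => ?_)
      have hr0 : (0:ℝ) < r := hS0 hr
      have hre : 0 ≤ ((t:ℂ) * r * w).re := by
        have : ((t:ℂ) * r * w).re = (t * r * w.re) := by simp [Complex.mul_re]
        rw [this]; positivity
      have := hb _ hre
      rw [← sub_mul, norm_mul, norm_mul, neg_mul, neg_mul]
      refine (mul_le_mul_of_nonneg_right this (norm_nonneg _)).trans (le_of_eq ?_)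
      simp only [norm_mul, norm_pow, Complex.norm_real, Real.norm_of_nonneg h0.le, mul_pow]
      ring
    refine this.trans ?_
    rw [integral_const_mul]
    have htK : t ^ K ≤ t ^ L := by
      rw [← Real.rpow_natCast]
      exact Real.rpow_le_rpow_of_exponent_ge h0 h1.le hK
    have hnn : 0 ≤ ∫ r in S, ‖(r : ℂ) ^ K * g r‖ := integral_nonneg fun _ => norm_nonneg _
    calc _ = (C * ‖w‖ ^ K * ∫ r in S, ‖(r : ℂ) ^ K * g r‖) * t ^ K := by ring
      _ ≤ _ := by gcongr
  simpa using Submodule.add_mem _ hrest hpm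

lemma Ici_sub : Set.Ici (1 : ℝ) ⊆ Set.Ioi 0 := Set.Ici_subset_Ioi.2 one_pos

/-- integrability of a bounded continuous function against the exponential -/
lemma exp_integrable (w : ℂ) (hw : 0 < w.re) (t : ℝ) (ht : 0 < t) (a : ℝ) (f : ℝ → ℂ)
    (hf : ContinuousOn f (Set.Ici a)) (hb : f =O[atTop] fun _ => (1 : ℝ)) :
    IntegrableOn (fun r : ℝ => Complex.exp (-(t : ℂ) * (r : ℂ) * w) * f r) (Set.Ioi a) := by
  have hre : ∀ r : ℝ, (-(t:ℂ) * r * w).re = -(t * w.re) * r := fun r => by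
    simp [Complex.mul_re]; ring
  refine IntegrableOn.mono_set ?_ Set.Ioi_subset_Ici_self
  refine (ContinuousOn.locallyIntegrableOn ?_ measurableSet_Ici).integrableOn_of_isBigO_atTop
      (g := fun r => Real.exp (-(t * w.re) * r)) ?_
      ⟨Set.Ioi 0, Ioi_mem_atTop 0, integrableOn_exp_mul_Ioi (by nlinarith [mul_pos ht hw]) 0⟩
  · exact (by fun_prop : Continuous fun r : ℝ => Complex.exp (-(t : ℂ) * (r : ℂ) * w)).continuousOn.mul hf
  · have : (fun r : ℝ => Complex.exp (-(t : ℂ) * (r : ℂ) * w)) =O[atTop] fun r : ℝ => Real.exp (-(t * w.re) * r) := by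
      refine IsBigO.of_bound 1 (Eventually.of_forall fun r => ?_)
      rw [Complex.norm_exp, hre]; simp
    simpa using this.mul hb

lemma pw_bdd {s : ℝ} (hs : s ≤ 0) : pw s =O[atTop] fun _ => (1 : ℝ) := by
  refine IsBigO.of_bound 1 ?_
  filter_upwards [eventually_ge_atTop 1] with r hr
  simp only [pw, Complex.norm_real]
  rw [Real.norm_of_nonneg (by positivity)]
  simpa using Real.rpow_le_one_of_one_le_of_nonpos hr hs

lemma pw_cont (s : ℝ) : ContinuousOn (pw s) (Set.Ioi 0) := by
  unfold pw
  refine Complex.continuous_ofReal.comp_continuousOn ?_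
  exact continuousOn_id.rpow_const fun x hx => Or.inl (ne_of_gt hx)

lemma ray_expansion {E : Set ℝ} (hE : ∀ k : ℕ, (k : ℝ) ∈ E) (L : ℝ) (w : ℂ) (hw : 0 < w.re)
    (f : ℝ → ℂ) (hf : ContinuousOn f (Set.Ici 0)) (hfb : f =O[atTop] fun _ => (1 : ℝ))
    (s : ℕ → ℝ) (hs : ∀ j, s j ≤ 0) (a : ℕ → ℂ) (J : ℕ) (K : ℕ) (hK : L ≤ K)
    (hJ : s J + K < -1)
    (hexp : (fun r => f r - ∑ j ∈ Finset.range J, a j * pw (s j) r) =O[atTop] fun r => r ^ (s J)) :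
    ((fun t : ℝ => ∫ r in Set.Ioi (0:ℝ), Complex.exp (-(t : ℂ) * (r : ℂ) * w) * f r) -
      ∑ j ∈ Finset.range J, a j •
        (fun t : ℝ => ∫ r in Set.Ioi (1:ℝ), Complex.exp (-(t : ℂ) * (r : ℂ) * w) * pw (s j) r))
      ∈ ML E L := by
  set g : ℝ → ℂ := fun r => f r - ∑ j ∈ Finset.range J, a j * pw (s j) r with hgdef
  have hgc : ContinuousOn g (Set.Ici 1) := by
    refine (hf.mono (Set.Ici_subset_Ici.2 zero_le_one)).sub ?_
    refine continuousOn_finsetSum _ fun j _ => continuousOn_const.mul ((pw_cont _).mono Ici_sub)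
  have h1 : (fun t : ℝ => ∫ r in Set.Ioc (0:ℝ) 1, Complex.exp (-(t : ℂ) * (r : ℂ) * w) * f r) ∈ ML E L := by
    refine moment_mem hE L w hw _ measurableSet_Ioc (fun x hx => hx.1) f K hK fun k _ => ?_
    have : ContinuousOn (fun r : ℝ => (r:ℂ) ^ k * f r) (Set.Icc 0 1) :=
      (by fun_prop : Continuous fun r : ℝ => (r:ℂ) ^ k).continuousOn.mul
        (hf.mono Set.Icc_subset_Ici_self)
    exact this.integrableOn_Icc.mono_set Set.Ioc_subset_Icc_self
  have h2 : (fun t : ℝ => ∫ r in Set.Ioi (1:ℝ), Complex.exp (-(t : ℂ) * (r : ℂ) * w) * g r) ∈ ML E L := by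
    refine moment_mem hE L w hw _ measurableSet_Ioi (Set.Ioi_subset_Ioi zero_le_one) g K hK fun k hk => ?_
    have hc : ContinuousOn (fun r : ℝ => (r:ℂ) ^ k * g r) (Set.Ici 1) :=
      (by fun_prop : Continuous fun r : ℝ => (r:ℂ) ^ k).continuousOn.mul hgc
    refine IntegrableOn.mono_set ?_ Set.Ioi_subset_Ici_self
    refine (hc.locallyIntegrableOn measurableSet_Ici).integrableOn_of_isBigO_atTop
      (g := fun r => r ^ (k + s J)) ?_ ?_
    · have : (fun r : ℝ => (r:ℂ) ^ k) =O[atTop] fun r : ℝ => r ^ k := by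
        refine IsBigO.of_bound 1 (Eventually.of_forall fun r => by simp)
      refine (this.mul hexp).trans (IsBigO.of_bound 1 ?_)
      filter_upwards [eventually_gt_atTop 0] with r hr
      rw [Real.rpow_add hr, Real.rpow_natCast, one_mul]
    · rw [integrableAtFilter_rpow_atTop_iff]
      have : (k:ℝ) ≤ K := by exact_mod_cast hk
      linarith
  refine ML_congr 1 one_pos ?_ (Submodule.add_mem _ h1 h2)
  intro t h0 _
  have hIf := exp_integrable w hw t h0 0 f hf hfb
  have hIp : ∀ j, IntegrableOn (fun r : ℝ => Complex.exp (-(t : ℂ) * (r : ℂ) * w) * pw (s j) r) (Set.Ioi 1) :=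
    fun j => exp_integrable w hw t h0 1 _ ((pw_cont _).mono Ici_sub) (pw_bdd (hs j))
  simp only [Pi.sub_apply, Pi.add_apply, Finset.sum_apply, Pi.smul_apply, smul_eq_mul]
  rw [← Set.Ioc_union_Ioi_eq_Ioi (zero_le_one' ℝ),
    setIntegral_union (Set.Ioc_disjoint_Ioi le_rfl) measurableSet_Ioi
      (hIf.mono_set Set.Ioc_subset_Ioi_self) (hIf.mono_set (Set.Ioi_subset_Ioi zero_le_one)),
    add_sub_assoc]
  congr 1
  have : ∀ r : ℝ, Complex.exp (-(t : ℂ) * (r : ℂ) * w) * g r = Complex.exp (-(t : ℂ) * (r : ℂ) * w) * f r -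
      ∑ j ∈ Finset.range J, a j * (Complex.exp (-(t : ℂ) * (r : ℂ) * w) * pw (s j) r) := by
    intro r
    rw [hgdef]; simp only [mul_sub, Finset.mul_sum]
    congr 1
    exact Finset.sum_congr rfl fun j _ => by ring
  simp_rw [this]
  rw [integral_sub (hIf.mono_set (Set.Ioi_subset_Ioi zero_le_one))
    (integrable_finsetSum _ fun j _ => (hIp j).const_mul _),
    integral_finsetSum _ fun j _ => (hIp j).const_mul _]
  simp_rw [integral_const_mul]

lemma I_expansion {E : Set ℝ} (hE : ∀ k : ℕ, (k : ℝ) ∈ E) (L : ℝ) (w : ℂ) (hw : 0 < w.re)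
    (s : ℝ) (hs : s ≤ 0) (hsE : -s - 1 ∈ E) (ℓ : ℝ → ℂ)
    (hℓ : (∀ k : ℕ, s ≠ -k - 1) → ℓ = 0)
    (hℓ' : ∀ k : ℕ, s = -k - 1 → ℓ = fun t : ℝ => (-w) ^ k / (k.factorial : ℂ) * (t : ℂ) ^ k * (Real.log t : ℂ)) :
    (fun t : ℝ => ∫ r in Set.Ioi (1:ℝ), Complex.exp (-(t : ℂ) * (r : ℂ) * w) * pw s r) + ℓ
      ∈ ML E L := by
  obtain ⟨K, hK⟩ := exists_nat_gt (max L (-s - 1))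
  have hKL : L ≤ K := ((le_max_left _ _).trans_lt hK).le
  have hKs : -1 < K + s := by have := (le_max_right _ _).trans_lt hK; linarith
  obtain ⟨C, hC, hb⟩ := taylor_bound K
  set Rm : ℝ → ℂ := fun r => (Complex.exp (-(r * w)) - ∑ k ∈ Finset.range K, (-(r * w)) ^ k / (k.factorial : ℂ)) * pw s r with hRm
  have hRb : ∀ r : ℝ, 0 < r → ‖Rm r‖ ≤ C * ‖w‖ ^ K * r ^ (K + s) := by
    intro r hr
    have hre : 0 ≤ ((r:ℂ) * w).re := by
      simp [Complex.mul_re]; positivity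
    rw [hRm, norm_mul]
    refine (mul_le_mul_of_nonneg_right (hb _ hre) (norm_nonneg _)).trans (le_of_eq ?_)
    rw [norm_mul, Complex.norm_real, Real.norm_of_nonneg hr.le, pw, Complex.norm_real,
      Real.norm_of_nonneg (by positivity), Real.rpow_add hr, Real.rpow_natCast]
    ring
  have hRc : ContinuousOn Rm (Set.Ioi 0) := by
    refine ContinuousOn.mul ?_ (pw_cont s)
    exact (by fun_prop : Continuous fun r : ℝ => (Complex.exp (-(r * w)) - ∑ k ∈ Finset.range K, (-(r * w)) ^ k / (k.factorial : ℂ))).continuousOn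
  have hint : ∀ b : ℝ, 0 ≤ b → IntervalIntegrable (fun r : ℝ => C * ‖w‖ ^ K * r ^ (K + s)) volume 0 b :=
    fun b _ => (intervalIntegral.intervalIntegrable_rpow' hKs).const_mul _
  have hRi : ∀ b : ℝ, 0 ≤ b → IntervalIntegrable Rm volume 0 b := by
    intro b hb0
    have := hint b hb0
    rw [intervalIntegrable_iff_integrableOn_Ioc_of_le hb0] at this ⊢
    refine Integrable.mono' this ((hRc.mono Set.Ioc_subset_Ioi_self).aestronglyMeasurable measurableSet_Ioc) ?_
    exact (ae_restrict_iff' measurableSet_Ioc).2 (ae_of_all _ fun r hr => hRb r hr.1)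
  have hRt : ∀ t : ℝ, 0 < t → ‖∫ r in (0:ℝ)..t, Rm r‖ ≤ C * ‖w‖ ^ K / (K + s + 1) * t ^ (K + s + 1) := by
    intro t ht
    refine (intervalIntegral.norm_integral_le_of_norm_le ht.le (ae_of_all _ fun r hr => hRb r hr.1) (hint t ht.le)).trans ?_
    rw [intervalIntegral.integral_const_mul, integral_rpow (Or.inl hKs), Real.zero_rpow (by linarith)]
    apply le_of_eq; ring
  set B : ℂ := ∫ r in Set.Ioi (1:ℝ), Complex.exp (-(r * w)) * pw s r
  set D : ℂ := ∫ r in (0:ℝ)..1, Rm r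
  -- the polynomial part
  set q : ℕ → ℝ → ℂ := fun k t => if s = -k - 1 then -((t:ℂ) ^ k * (Real.log t : ℂ)) else
    (((s + k + 1 : ℝ) : ℂ)⁻¹ * (pw (-s - 1) t - pw k t)) with hq
  have hpow : ∀ t : ℝ, 0 < t → t < 1 → ∀ k : ℕ,
      pw (-s - 1) t * (∫ r in t..1, pw (s + k) r) = q k t := by
    intro t h0 h1 k
    have hnot : (0:ℝ) ∉ Set.uIcc t 1 := by
      rw [Set.uIcc_of_le h1.le]; intro h; exact absurd h.1 (not_le.2 h0)
    simp only [hq]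
    split_ifs with hh
    · have e1 : s + k = -1 := by rw [hh]; ring
      have e2 : -s - 1 = k := by rw [hh]; ring
      rw [e1, e2]
      simp only [pw, Real.rpow_neg_one, Real.rpow_natCast]
      rw [intervalIntegral.integral_ofReal, integral_inv hnot]
      simp [Real.log_inv]
    · have hne : s + k ≠ -1 := fun h => hh (by linarith)
      simp only [pw]
      rw [intervalIntegral.integral_ofReal, integral_rpow (Or.inr ⟨hne, hnot⟩), ← Complex.ofReal_mul,
        ← Complex.ofReal_sub, ← Complex.ofReal_inv, ← Complex.ofReal_mul, Real.one_rpow]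
      congr 1
      have : t ^ (k:ℝ) = t ^ (-s - 1) * t ^ (s + k + 1) := by
        rw [← Real.rpow_add h0]; congr 1; ring
      rw [this]; ring
  have hq1 : (∑ k ∈ Finset.range K, ((-w) ^ k / (k.factorial : ℂ)) • q k) + ℓ ∈ ML E L := by
    have hgen : ∀ k : ℕ, s ≠ -k - 1 → q k ∈ ML E L := by
      intro k hk
      have : q k = ((s + k + 1 : ℝ) : ℂ)⁻¹ • (pw (-s - 1) - pw k) := by
        funext t; simp only [hq, if_neg hk]; simp
      rw [this]
      exact Submodule.smul_mem _ _ (Submodule.sub_mem _ (pw_mem hsE) (pw_mem (hE k)))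
    by_cases hk : ∃ k : ℕ, s = -k - 1
    · obtain ⟨k0, hk0⟩ := hk
      have hk0K : k0 ∈ Finset.range K := by
        rw [Finset.mem_range]
        have : (k0 : ℝ) < K := by linarith
        exact_mod_cast this
      rw [← Finset.add_sum_erase _ _ hk0K, hℓ' k0 hk0]
      have hz : ((-w) ^ k0 / (k0.factorial : ℂ)) • q k0 +
          (fun t : ℝ => (-w) ^ k0 / (k0.factorial : ℂ) * (t : ℂ) ^ k0 * (Real.log t : ℂ)) = 0 := by
        funext t
        simp only [hq, Pi.add_apply, Pi.smul_apply, smul_eq_mul, if_pos hk0, Pi.zero_apply]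
        ring
      rw [add_right_comm, hz, zero_add]
      refine Submodule.sum_mem _ fun k hk => Submodule.smul_mem _ _ (hgen k fun h => ?_)
      have : (k : ℝ) = k0 := by linarith
      exact (Finset.mem_erase.1 hk).1 (by exact_mod_cast this)
    · push Not at hk
      rw [hℓ hk, add_zero]
      exact Submodule.sum_mem _ fun k _ => Submodule.smul_mem _ _ (hgen k (hk k))
  have hO : (fun t : ℝ => -(pw (-s - 1) t * ∫ r in (0:ℝ)..t, Rm r)) ∈ ML E L := by
    refine OL_mem (C * ‖w‖ ^ K / (K + s + 1)) 1 one_pos fun t h0 h1 => ?_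
    rw [norm_neg, norm_mul, pw, Complex.norm_real, Real.norm_of_nonneg (by positivity)]
    calc _ ≤ t ^ (-s - 1) * (C * ‖w‖ ^ K / (K + s + 1) * t ^ (K + s + 1)) := by
            gcongr; exact hRt t h0
      _ = C * ‖w‖ ^ K / (K + s + 1) * (t ^ (-s - 1) * t ^ (K + s + 1)) := by ring
      _ = C * ‖w‖ ^ K / (K + s + 1) * t ^ (K : ℝ) := by
            rw [← Real.rpow_add h0]; congr 2; ring
      _ ≤ _ := by
            have : 0 < K + s + 1 := by linarith
            gcongr ?_ * ?_
            exact Real.rpow_le_rpow_of_exponent_ge h0 h1.le hKL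
  refine ML_congr 1 one_pos ?_ (Submodule.add_mem _ hq1 (Submodule.add_mem _ hO
    (Submodule.smul_mem _ (B + D) (pw_mem hsE))))
  intro t h0 h1
  -- scaling
  have hsc : (∫ r in Set.Ioi (1:ℝ), Complex.exp (-(t : ℂ) * (r : ℂ) * w) * pw s r) =
      pw (-s - 1) t * ∫ r in Set.Ioi t, Complex.exp (-(r * w)) * pw s r := by
    have := integral_comp_mul_left_Ioi (fun r : ℝ => Complex.exp (-(r * w)) * pw s r) 1 h0
    rw [mul_one] at this
    have e1 : (∫ r in Set.Ioi t, Complex.exp (-(r * w)) * pw s r) = (t:ℂ) *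
        ∫ r in Set.Ioi (1:ℝ), Complex.exp (-((t * r : ℝ) * w)) * pw s (t * r) := by
      rw [this, Complex.real_smul, ← mul_assoc, ← Complex.ofReal_mul, mul_inv_cancel₀ h0.ne']
      simp
    rw [e1, ← mul_assoc, ← integral_const_mul]
    refine setIntegral_congr_fun measurableSet_Ioi fun r hr => ?_
    have hr0 : (0:ℝ) < r := one_pos.trans hr
    simp only [pw]
    rw [Real.mul_rpow h0.le hr0.le]
    have : t ^ (-s - 1) * t * t ^ s = 1 := by
      nth_rewrite 2 [← Real.rpow_one t]
      rw [← Real.rpow_add h0, ← Real.rpow_add h0]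
      have : -s - 1 + 1 + s = 0 := by ring
      rw [this, Real.rpow_zero]
    have h2 : ((t ^ (-s - 1) : ℝ) : ℂ) * (t : ℂ) * ((t ^ s : ℝ) : ℂ) = 1 := by
      rw [← Complex.ofReal_mul, ← Complex.ofReal_mul, this, Complex.ofReal_one]
    push_cast
    rw [show -(t:ℂ) * r * w = -(t * r * w) by ring]
    linear_combination (-(Complex.exp (-(t * r * w)) * ((r ^ s : ℝ) : ℂ))) * h2
  have hIi : IntegrableOn (fun r : ℝ => Complex.exp (-(r * w)) * pw s r) (Set.Ioi t) := by
    have := exp_integrable w hw 1 one_pos t (pw s) ((pw_cont _).mono (Set.Ici_subset_Ioi.2 h0)) (pw_bdd hs)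
    refine this.congr (ae_of_all _ fun r => ?_)
    simp
  have hsplit : (∫ r in Set.Ioi t, Complex.exp (-(r * w)) * pw s r) =
      (∫ r in t..1, Complex.exp (-(r * w)) * pw s r) + B := by
    rw [← Set.Ioc_union_Ioi_eq_Ioi h1.le, setIntegral_union (Set.Ioc_disjoint_Ioi le_rfl) measurableSet_Ioi
      (hIi.mono_set Set.Ioc_subset_Ioi_self) (hIi.mono_set (Set.Ioi_subset_Ioi h1.le)),
      intervalIntegral.integral_of_le h1.le]
  have hsub : Set.uIcc t 1 ⊆ Set.Ioi 0 := by
    rw [Set.uIcc_of_le h1.le]; intro x hx; exact lt_of_lt_of_le h0 hx.1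
  have hpi : ∀ k : ℕ, IntervalIntegrable (fun r => (-w) ^ k / (k.factorial : ℂ) * pw (s + k) r) volume t 1 :=
    fun k => (((pw_cont _).mono hsub).intervalIntegrable).const_mul _
  have hRti : IntervalIntegrable Rm volume t 1 := (hRc.mono hsub).intervalIntegrable
  have hmid : (∫ r in t..1, Complex.exp (-(r * w)) * pw s r) =
      (∑ k ∈ Finset.range K, (-w) ^ k / (k.factorial : ℂ) * ∫ r in t..1, pw (s + k) r) +
      (D - ∫ r in (0:ℝ)..t, Rm r) := by
    have e1 : D - (∫ r in (0:ℝ)..t, Rm r) = ∫ r in t..1, Rm r :=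
      intervalIntegral.integral_interval_sub_left (hRi 1 zero_le_one) (hRi t h0.le)
    rw [e1]
    simp_rw [← intervalIntegral.integral_const_mul]
    have hsumi : IntervalIntegrable (fun r => ∑ k ∈ Finset.range K, (-w) ^ k / (k.factorial : ℂ) * pw (s + k) r) volume t 1 := by
      refine ContinuousOn.intervalIntegrable (continuousOn_finsetSum _ fun k _ => ?_)
      exact continuousOn_const.mul ((pw_cont _).mono hsub)
    rw [← intervalIntegral.integral_finsetSum fun k _ => hpi k,
      ← intervalIntegral.integral_add hsumi hRti]
    refine intervalIntegral.integral_congr fun r hr => ?_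
    have hr0 : (0:ℝ) < r := hsub hr
    have e3 : ∑ k ∈ Finset.range K, (-w) ^ k / (k.factorial : ℂ) * pw (s + k) r =
        (∑ k ∈ Finset.range K, (-(r * w)) ^ k / (k.factorial : ℂ)) * pw s r := by
      rw [Finset.sum_mul]
      refine Finset.sum_congr rfl fun k _ => ?_
      simp only [pw]
      rw [Real.rpow_add hr0, Real.rpow_natCast, neg_pow w, neg_pow ((r:ℂ) * w), mul_pow]
      push_cast
      ring
    simp only [hRm]
    rw [e3]
    ring
  simp only [Pi.add_apply, Pi.smul_apply, smul_eq_mul, Finset.sum_apply]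
  rw [hsc, hsplit, hmid]
  simp_rw [← hpow t h0 h1]
  simp only [mul_add, add_mul, mul_sub, Finset.mul_sum]
  have : ∀ k : ℕ, pw (-s - 1) t * ((-w) ^ k / (k.factorial : ℂ) * ∫ r in t..1, pw (s + k) r) =
    (-w) ^ k / (k.factorial : ℂ) * (pw (-s - 1) t * ∫ r in t..1, pw (s + k) r) := fun k => by ring
  simp_rw [this]
  ring

lemma arg_iff {δ : ℝ} (h0 : 0 < δ) (h1 : δ < Real.pi / 2) {z : ℂ} (hz : z ≠ 0) :
    δ ≤ |Complex.arg z| ↔ z.re ≤ ‖z‖ * Real.cos δ := by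
  have hn : 0 < ‖z‖ := norm_pos_iff.2 hz
  have hre : z.re = ‖z‖ * Real.cos |Complex.arg z| := by
    rw [Real.cos_abs, Complex.cos_arg hz]; field_simp
  have hpi := Complex.abs_arg_le_pi z
  rw [hre, mul_le_mul_iff_right₀ hn]
  exact (Real.strictAntiOn_cos.le_iff_ge ⟨abs_nonneg _, hpi⟩ ⟨h0.le, by linarith [Real.pi_pos]⟩).symm

lemma cos_le_of_mem {δ θ : ℝ} (h0 : 0 < δ) (h1 : δ < Real.pi / 2)
    (hθ : θ ∈ Set.Icc δ (2 * Real.pi - δ)) : Real.cos θ ≤ Real.cos δ := by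
  rcases le_total θ Real.pi with h | h
  · exact Real.cos_le_cos_of_nonneg_of_le_pi h0.le h hθ.1
  · have : Real.cos θ = Real.cos (2 * Real.pi - θ) := by rw [Real.cos_two_pi_sub]
    rw [this]
    exact Real.cos_le_cos_of_nonneg_of_le_pi h0.le (by linarith) (by linarith [hθ.2])

lemma cos_lt_of_mem {δ θ : ℝ} (h0 : 0 < δ) (h1 : δ < Real.pi / 2)
    (hθ : θ ∈ Set.Ioo δ (2 * Real.pi - δ)) : Real.cos θ < Real.cos δ := by
  rcases le_total θ Real.pi with h | h
  · exact Real.cos_lt_cos_of_nonneg_of_le_pi h0.le h hθ.1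
  · have : Real.cos θ = Real.cos (2 * Real.pi - θ) := by rw [Real.cos_two_pi_sub]
    rw [this]
    exact Real.cos_lt_cos_of_nonneg_of_le_pi h0.le (by linarith) (by linarith [hθ.2])

/-- the homogeneous term -/
noncomputable def hom (c : ℂ → ℂ) (s : ℝ) : ℂ → ℂ := fun z => c (z / ‖z‖) * ((‖z‖ ^ s : ℝ) : ℂ)

lemma hom_scale (c : ℂ → ℂ) (s : ℝ) (x : ℝ) (hx : 0 < x) (z : ℂ) :
    hom c s (x * z) = ((x ^ s : ℝ) : ℂ) * hom c s z := by
  have e : (x * z : ℂ) / (‖(x * z : ℂ)‖ : ℂ) = z / ‖z‖ := by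
    rw [norm_mul, Complex.norm_real, Real.norm_of_nonneg hx.le]
    push_cast
    have : (x : ℂ) ≠ 0 := by exact_mod_cast hx.ne'
    rw [mul_div_mul_left _ _ this]
  unfold hom
  rw [e, norm_mul, Complex.norm_real, Real.norm_of_nonneg hx.le, Real.mul_rpow hx.le (norm_nonneg _)]
  push_cast
  ring

/-- the open sector -/
def US (δ : ℝ) : Set ℂ := {z : ℂ | z.re < ‖z‖ * Real.cos δ}

lemma US_open (δ : ℝ) : IsOpen (US δ) :=
  isOpen_lt Complex.continuous_re (continuous_norm.mul continuous_const)

lemma US_ne {δ : ℝ} {z : ℂ} (hz : z ∈ US δ) : z ≠ 0 := by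
  rintro rfl
  simp [US] at hz

lemma US_scale {δ : ℝ} {z : ℂ} (hz : z ∈ US δ) {x : ℝ} (hx : 0 < x) : (x * z : ℂ) ∈ US δ := by
  have hz' : z.re < ‖z‖ * Real.cos δ := hz
  change (x * z : ℂ).re < ‖(x * z : ℂ)‖ * Real.cos δ
  rw [norm_mul, Complex.norm_real, Real.norm_of_nonneg hx.le, Complex.re_ofReal_mul, mul_assoc]
  gcongr

lemma hom_holo (δ : ℝ) (F : ℂ → ℂ) (hF : DifferentiableOn ℂ F (US δ))
    (s : ℕ → ℝ) (hs : ∀ j, s j ≤ 0) (hs' : ∀ j, s (j + 1) < s j) (c : ℕ → ℂ → ℂ)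
    (hexp : ∀ J : ℕ, 1 ≤ J → ∃ C R : ℝ, 0 < C ∧ 0 < R ∧ ∀ z ∈ US δ, R ≤ ‖z‖ →
      ‖F z - ∑ j ∈ Finset.range J, hom (c j) (s j) z‖ ≤ C * ‖z‖ ^ (s J)) (j : ℕ) :
    DifferentiableOn ℂ (hom (c j) (s j)) (US δ) := by
  induction j using Nat.strong_induction_on with
  | _ j ih =>
  obtain ⟨C, R, hC, hR, hb⟩ := hexp (j + 1) (by omega)
  have hlim : TendstoLocallyUniformlyOn
      (fun (x : ℝ) (z : ℂ) => ((x ^ (-(s j)) : ℝ) : ℂ) *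
        (F (x * z) - ∑ i ∈ Finset.range j, hom (c i) (s i) (x * z)))
      (hom (c j) (s j)) atTop (US δ) := by
    rw [tendstoLocallyUniformlyOn_iff_forall_isCompact (US_open δ)]
    intro K hKU hK
    obtain ⟨ρ, hρ, hρK⟩ : ∃ ρ : ℝ, 0 < ρ ∧ ∀ z ∈ K, ρ ≤ ‖z‖ := by
      rcases K.eq_empty_or_nonempty with rfl | hne
      · exact ⟨1, one_pos, by simp⟩
      · obtain ⟨z0, hz0, hmin⟩ := hK.exists_isMinOn hne continuous_norm.continuousOn
        exact ⟨‖z0‖, norm_pos_iff.2 (US_ne (hKU hz0)), fun z hz => hmin hz⟩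
    rw [Metric.tendstoUniformlyOn_iff]
    intro ε hε
    have ht : Tendsto (fun x : ℝ => C * ρ ^ (s (j + 1)) * x ^ (-(s j - s (j + 1)))) atTop (𝓝 0) := by
      have := (tendsto_rpow_neg_atTop (sub_pos.2 (hs' j))).const_mul (C * ρ ^ (s (j + 1)))
      simpa using this
    filter_upwards [ht.eventually (gt_mem_nhds hε), eventually_gt_atTop 0, eventually_ge_atTop (R / ρ)]
      with x hx1 hx0 hxR z hz
    have hxz : R ≤ ‖(x * z : ℂ)‖ := by
      rw [norm_mul, Complex.norm_real, Real.norm_of_nonneg hx0.le]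
      rw [div_le_iff₀ hρ] at hxR
      exact hxR.trans (by gcongr; exact hρK z hz)
    have h1 := hb _ (US_scale (hKU hz) hx0) hxz
    rw [Finset.sum_range_succ, hom_scale (c j) (s j) x hx0 z] at h1
    have hxx : ((x ^ (-(s j)) : ℝ) : ℂ) * ((x ^ (s j) : ℝ) : ℂ) = 1 := by
      rw [← Complex.ofReal_mul, ← Real.rpow_add hx0]; simp
    rw [dist_comm, dist_eq_norm]
    have e : ((x ^ (-(s j)) : ℝ) : ℂ) * (F (x * z) - ∑ i ∈ Finset.range j, hom (c i) (s i) (x * z)) -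
        hom (c j) (s j) z = ((x ^ (-(s j)) : ℝ) : ℂ) * (F (x * z) -
          (∑ i ∈ Finset.range j, hom (c i) (s i) (x * z) + ((x ^ (s j) : ℝ) : ℂ) * hom (c j) (s j) z)) := by
      linear_combination (hom (c j) (s j) z) * hxx
    rw [e, norm_mul, Complex.norm_real, Real.norm_of_nonneg (by positivity)]
    refine lt_of_le_of_lt ?_ hx1
    have hzn : 0 < ‖z‖ := hρ.trans_le (hρK z hz)
    calc _ ≤ x ^ (-(s j)) * (C * ‖(x * z : ℂ)‖ ^ (s (j + 1))) := by gcongr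
      _ = C * ‖z‖ ^ (s (j + 1)) * (x ^ (-(s j)) * x ^ (s (j + 1))) := by
          rw [norm_mul, Complex.norm_real, Real.norm_of_nonneg hx0.le,
            Real.mul_rpow hx0.le (norm_nonneg _)]
          ring
      _ = C * ‖z‖ ^ (s (j + 1)) * x ^ (-(s j - s (j + 1))) := by
          rw [← Real.rpow_add hx0]; congr 2; ring
      _ ≤ _ := by
          gcongr ?_ * ?_ * ?_
          exact Real.rpow_le_rpow_of_nonpos hρ (hρK z hz) (hs _)
  refine hlim.differentiableOn ?_ (US_open δ)
  filter_upwards [eventually_gt_atTop 0] with x hx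
  have hsc : Set.MapsTo (fun z : ℂ => (x * z : ℂ)) (US δ) (US δ) := fun z hz => US_scale hz hx
  have hd : DifferentiableOn ℂ (fun z : ℂ => (x * z : ℂ)) (US δ) := by fun_prop
  refine DifferentiableOn.const_mul ?_ _
  refine (hF.comp hd hsc).sub ?_
  refine DifferentiableOn.fun_sum fun i hi => ?_
  exact (ih i (Finset.mem_range.1 hi)).comp hd hsc

lemma boundary_eq (δ : ℝ) (h0 : 0 < δ) (h1 : δ < Real.pi / 2) (c : ℂ → ℂ) (k : ℕ)
    (hc : ContinuousOn c {ω : ℂ | ‖ω‖ = 1 ∧ δ ≤ |Complex.arg ω|})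
    (hd : DifferentiableOn ℂ (hom c (-k - 1)) (US δ)) :
    c (Complex.exp (δ * Complex.I)) * Complex.exp (δ * Complex.I) ^ (k + 1) =
    c (Complex.exp (-δ * Complex.I)) * Complex.exp (-δ * Complex.I) ^ (k + 1) := by
  set Q : ℂ → ℂ := fun z => hom c (-k - 1) z * z ^ (k + 1) with hQ
  have hQd : DifferentiableOn ℂ Q (US δ) := hd.mul (by fun_prop)
  have hQs : ∀ z : ℂ, ∀ x : ℝ, 0 < x → Q (x * z) = Q z := by
    intro z x hx
    simp only [hQ]
    rw [hom_scale _ _ _ hx, mul_pow]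
    have : ((x ^ (-(k:ℝ) - 1) : ℝ) : ℂ) * (x : ℂ) ^ (k + 1) = 1 := by
      rw [← Complex.ofReal_pow, ← Complex.ofReal_mul, ← Real.rpow_natCast, ← Real.rpow_add hx]
      push_cast
      norm_num
    linear_combination (hom c (-k - 1) z * z ^ (k + 1)) * this
  have hQ' : ∀ z ∈ US δ, HasDerivAt Q 0 z := by
    intro z hz
    have hz1 := (hQd.differentiableAt ((US_open δ).mem_nhds hz)).hasDerivAt
    have h2 : HasDerivAt (fun x : ℝ => Q ((x : ℂ) * z)) (deriv Q z * z) 1 := by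
      have hm : HasDerivAt (fun x : ℝ => ((x : ℂ) * z)) z (1 : ℝ) := by
        simpa using (Complex.ofRealCLM.hasDerivAt (x := (1:ℝ))).mul_const z
      have hz2 : HasDerivAt Q (deriv Q z) ((fun x : ℝ => ((x : ℂ) * z)) 1) := by simpa using hz1
      exact hz2.comp (1:ℝ) hm
    have h3 : HasDerivAt (fun x : ℝ => Q ((x : ℂ) * z)) 0 1 := by
      refine (hasDerivAt_const (1:ℝ) (Q z)).congr_of_eventuallyEq ?_
      filter_upwards [lt_mem_nhds (zero_lt_one' ℝ)] with x hx
      exact hQs z x hx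
    have h4 := h2.unique h3
    have h5 : deriv Q z = 0 := (mul_eq_zero.1 h4).resolve_right (US_ne hz)
    rwa [h5] at hz1
  set g : ℝ → ℂ := fun θ => c (Complex.exp (θ * Complex.I)) * Complex.exp (θ * Complex.I) ^ (k + 1) with hg
  have hgQ : ∀ θ : ℝ, g θ = Q (Complex.exp (θ * Complex.I)) := by
    intro θ
    simp [hg, hQ, hom, Complex.norm_exp_ofReal_mul_I]
  have hgc : ContinuousOn g (Set.Icc δ (2 * Real.pi - δ)) := by
    have he : Continuous fun θ : ℝ => Complex.exp (θ * Complex.I) := by fun_prop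
    refine ContinuousOn.mul (hc.comp he.continuousOn ?_) (he.pow _).continuousOn
    intro θ hθ
    refine ⟨Complex.norm_exp_ofReal_mul_I θ, ?_⟩
    rw [arg_iff h0 h1 (Complex.exp_ne_zero _), Complex.norm_exp_ofReal_mul_I, Complex.exp_ofReal_mul_I_re, one_mul]
    exact cos_le_of_mem h0 h1 hθ
  have hgd : ∀ θ ∈ Set.Ioo δ (2 * Real.pi - δ), HasDerivAt g 0 θ := by
    intro θ hθ
    have hmem : Complex.exp (θ * Complex.I) ∈ US δ := by
      change (Complex.exp (θ * Complex.I)).re < ‖Complex.exp (θ * Complex.I)‖ * Real.cos δ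
      rw [Complex.norm_exp_ofReal_mul_I, Complex.exp_ofReal_mul_I_re, one_mul]
      exact cos_lt_of_mem h0 h1 hθ
    have he : DifferentiableAt ℝ (fun θ : ℝ => Complex.exp (θ * Complex.I)) θ := by fun_prop
    have := (hQ' _ hmem).comp θ he.hasDerivAt
    rw [zero_mul] at this
    exact this.congr_of_eventuallyEq (Eventually.of_forall hgQ)
  have hlt : δ < 2 * Real.pi - δ := by linarith [Real.pi_pos]
  have hend : g (2 * Real.pi - δ) = g δ := by
    have hbd : (0:ℝ) < 2 * Real.pi - δ - δ := by linarith
    apply Complex.ext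
    · obtain ⟨x, hx, hx'⟩ := exists_hasDerivAt_eq_slope (fun θ => (g θ).re) (fun _ => 0) hlt
        (Complex.continuous_re.comp_continuousOn hgc)
        (fun x hx => by
          have := Complex.reCLM.hasFDerivAt.comp_hasDerivAt x (hgd x hx)
          rw [map_zero] at this
          exact this)
      rw [eq_comm, div_eq_zero_iff] at hx'
      exact sub_eq_zero.1 (hx'.resolve_right hbd.ne')
    · obtain ⟨x, hx, hx'⟩ := exists_hasDerivAt_eq_slope (fun θ => (g θ).im) (fun _ => 0) hlt
        (Complex.continuous_im.comp_continuousOn hgc)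
        (fun x hx => by
          have := Complex.imCLM.hasFDerivAt.comp_hasDerivAt x (hgd x hx)
          rw [map_zero] at this
          exact this)
      rw [eq_comm, div_eq_zero_iff] at hx'
      exact sub_eq_zero.1 (hx'.resolve_right hbd.ne')
  have hper : Complex.exp (((2 * Real.pi - δ : ℝ) : ℂ) * Complex.I) = Complex.exp (-δ * Complex.I) := by
    rw [show (((2 * Real.pi - δ : ℝ) : ℂ) * Complex.I) = -δ * Complex.I + 2 * Real.pi * Complex.I by push_cast; ring]
    exact Complex.exp_periodic _
  simp only [hg] at hend
  rw [hper] at hend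
  exact hend.symm

lemma ray_setup (δ : ℝ) (F : ℂ → ℂ)
    (hFc : ContinuousOn F ({0} ∪ {z : ℂ | z ≠ 0 ∧ δ ≤ |Complex.arg z|}))
    (s : ℕ → ℝ) (hs : ∀ j, s j ≤ 0) (c : ℕ → ℂ → ℂ)
    (hexp : ∀ J : ℕ, 1 ≤ J → ∃ C R : ℝ, 0 < C ∧ 0 < R ∧
      ∀ z : ℂ, z ≠ 0 → δ ≤ |Complex.arg z| → R ≤ ‖z‖ →
        ‖F z - ∑ j ∈ Finset.range J, hom (c j) (s j) z‖ ≤ C * ‖z‖ ^ (s J))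
    (w : ℂ) (hw1 : ‖w‖ = 1) (hw : δ ≤ |Complex.arg w|) :
    ContinuousOn (fun r : ℝ => F (r * w)) (Set.Ici 0) ∧
    ((fun r : ℝ => F (r * w)) =O[atTop] fun _ => (1 : ℝ)) ∧
    ∀ J : ℕ, 1 ≤ J → (fun r : ℝ => F (r * w) - ∑ j ∈ Finset.range J, c j w * pw (s j) r)
      =O[atTop] fun r => r ^ (s J) := by
  have hw0 : w ≠ 0 := by rintro rfl; simp at hw1
  have harg : ∀ r : ℝ, 0 < r → δ ≤ |Complex.arg (r * w)| := fun r hr => by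
    rwa [Complex.arg_real_mul _ hr]
  have hne : ∀ r : ℝ, 0 < r → (r * w : ℂ) ≠ 0 := fun r hr =>
    mul_ne_zero (by exact_mod_cast hr.ne') hw0
  have hnorm : ∀ r : ℝ, 0 < r → ‖(r * w : ℂ)‖ = r := fun r hr => by
    rw [norm_mul, hw1, Complex.norm_real, Real.norm_of_nonneg hr.le, mul_one]
  have hhom : ∀ j, ∀ r : ℝ, 0 < r → hom (c j) (s j) (r * w) = c j w * pw (s j) r := by
    intro j r hr
    rw [hom_scale _ _ _ hr]
    simp [hom, hw1, pw, mul_comm]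
  have h3 : ∀ J : ℕ, 1 ≤ J → (fun r : ℝ => F (r * w) - ∑ j ∈ Finset.range J, c j w * pw (s j) r)
      =O[atTop] fun r => r ^ (s J) := by
    intro J hJ
    obtain ⟨C, R, hC, hR, hb⟩ := hexp J hJ
    refine IsBigO.of_bound C ?_
    filter_upwards [eventually_gt_atTop 0, eventually_ge_atTop R] with r hr hrR
    have := hb _ (hne r hr) (harg r hr) (by rwa [hnorm r hr])
    rw [hnorm r hr, Finset.sum_congr rfl fun j _ => hhom j r hr] at this
    rwa [Real.norm_of_nonneg (by positivity)]
  refine ⟨?_, ?_, h3⟩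
  · refine hFc.comp (by fun_prop) ?_
    intro r hr
    rcases eq_or_lt_of_le (Set.mem_Ici.1 hr) with h | h
    · left; simp [← h]
    · right; exact ⟨hne r h, harg r h⟩
  · have h4 : (fun r : ℝ => r ^ (s 1)) =O[atTop] fun _ => (1 : ℝ) := by
      have := (pw_bdd (hs 1)).norm_left
      refine IsBigO.of_norm_left (this.congr_left fun r => ?_)
      simp [pw]
    have h5 := ((h3 1 le_rfl).trans h4).add ((pw_bdd (hs 0)).const_mul_left (c 0 w))
    refine h5.congr_left fun r => ?_
    simp

/-- From the asymptotic expansion of the resolvent trace `F(λ)` in the sector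
`Ω_δ = {0} ∪ {|Arg λ| ≥ δ}` one obtains, by a contour integral of `e^{-tλ}F(λ)/(2πi)`
over the two boundary rays, a complete small-time asymptotic expansion of the heat
trace `G(t)` in the powers `t^{(j-n)/m + N - 1}` and `t^k`, `j, k ∈ ℕ₀`. -/
theorem stmt_11 (δ : ℝ) (hδ : 0 < δ) (hδ' : δ < Real.pi / 2)
    (n m : ℕ) (hn : 1 ≤ n) (hm : 1 ≤ m) (N : ℝ) (hN : (n : ℝ) / (m : ℝ) < N)
    (F : ℂ → ℂ)
    (hFc : ContinuousOn F ({0} ∪ {z : ℂ | z ≠ 0 ∧ δ ≤ |Complex.arg z|}))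
    (hFh : DifferentiableOn ℂ F
      (interior ({0} ∪ {z : ℂ | z ≠ 0 ∧ δ ≤ |Complex.arg z|})))
    (c : ℕ → ℂ → ℂ)
    (hc : ∀ j : ℕ, ContinuousOn (c j) {ω : ℂ | ‖ω‖ = 1 ∧ δ ≤ |Complex.arg ω|})
    (hexp : ∀ J : ℕ, 1 ≤ J → ∃ C R : ℝ, 0 < C ∧ 0 < R ∧
      ∀ z : ℂ, z ≠ 0 → δ ≤ |Complex.arg z| → R ≤ ‖z‖ →
        ‖(F z - ∑ j ∈ Finset.range J,
            c j (z / ‖z‖) *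
              ((‖z‖ ^ (((n : ℝ) - (j : ℝ)) / (m : ℝ) - N) : ℝ) : ℂ))‖ ≤
          C * ‖z‖ ^ (((n : ℝ) - (J : ℝ)) / (m : ℝ) - N)) :
    (∀ t : ℝ, 0 < t →
      IntegrableOn (fun r : ℝ =>
        Complex.exp (-(t : ℂ) * (r : ℂ) * Complex.exp ((δ : ℂ) * Complex.I)) *
          F ((r : ℂ) * Complex.exp ((δ : ℂ) * Complex.I)) *
          Complex.exp ((δ : ℂ) * Complex.I)) (Set.Ioi 0) ∧
      IntegrableOn (fun r : ℝ =>
        Complex.exp (-(t : ℂ) * (r : ℂ) * Complex.exp (-(δ : ℂ) * Complex.I)) *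
          F ((r : ℂ) * Complex.exp (-(δ : ℂ) * Complex.I)) *
          Complex.exp (-(δ : ℂ) * Complex.I)) (Set.Ioi 0)) ∧
    ∃ α : ℝ → ℂ,
      (∀ e : ℝ,
        ¬ ((∃ j : ℕ, e = ((j : ℝ) - (n : ℝ)) / (m : ℝ) + N - 1) ∨ ∃ k : ℕ, e = (k : ℝ)) →
        α e = 0) ∧
      ∀ L : ℝ, ∃ C T : ℝ, 0 < C ∧ 0 < T ∧ ∀ t : ℝ, 0 < t → t ≤ T →
        ‖
          ((1 / (2 * (Real.pi : ℂ) * Complex.I)) *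
            ((∫ r in Set.Ioi (0 : ℝ),
                Complex.exp (-(t : ℂ) * (r : ℂ) * Complex.exp ((δ : ℂ) * Complex.I)) *
                  F ((r : ℂ) * Complex.exp ((δ : ℂ) * Complex.I)) *
                  Complex.exp ((δ : ℂ) * Complex.I)) -
              ∫ r in Set.Ioi (0 : ℝ),
                Complex.exp (-(t : ℂ) * (r : ℂ) * Complex.exp (-(δ : ℂ) * Complex.I)) *
                  F ((r : ℂ) * Complex.exp (-(δ : ℂ) * Complex.I)) *
                  Complex.exp (-(δ : ℂ) * Complex.I)) -
            ∑ᶠ e ∈ {e : ℝ |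
                ((∃ j : ℕ, e = ((j : ℝ) - (n : ℝ)) / (m : ℝ) + N - 1) ∨
                  ∃ k : ℕ, e = (k : ℝ)) ∧ e < L},
              α e * ((t ^ e : ℝ) : ℂ))‖ ≤ C * t ^ L := by
  set s : ℕ → ℝ := fun j => ((n : ℝ) - (j : ℝ)) / (m : ℝ) - N with hsdef
  have hm0 : (0:ℝ) < m := by exact_mod_cast hm
  have hs' : ∀ j, s (j + 1) < s j := by
    intro j
    simp only [hsdef]
    push_cast
    have : ((n:ℝ) - (j + 1)) / m < ((n:ℝ) - j) / m := by gcongr; linarith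
    linarith
  have hs : ∀ j, s j ≤ 0 := by
    intro j
    simp only [hsdef]
    have : ((n:ℝ) - j) / m ≤ (n:ℝ) / m := by
      gcongr
      have : (0:ℝ) ≤ j := by positivity
      linarith
    linarith
  have hexp' : ∀ J : ℕ, 1 ≤ J → ∃ C R : ℝ, 0 < C ∧ 0 < R ∧
      ∀ z : ℂ, z ≠ 0 → δ ≤ |Complex.arg z| → R ≤ ‖z‖ →
        ‖F z - ∑ j ∈ Finset.range J, hom (c j) (s j) z‖ ≤ C * ‖z‖ ^ (s J) := hexp
  have hUsub : US δ ⊆ interior ({0} ∪ {z : ℂ | z ≠ 0 ∧ δ ≤ |Complex.arg z|}) := by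
    refine interior_maximal ?_ (US_open δ)
    intro z hz
    right
    exact ⟨US_ne hz, (arg_iff hδ hδ' (US_ne hz)).2 (le_of_lt hz)⟩
  have hholo : ∀ j, DifferentiableOn ℂ (hom (c j) (s j)) (US δ) := by
    refine hom_holo δ F (hFh.mono hUsub) s hs hs' c ?_
    intro J hJ
    obtain ⟨C, R, hC, hR, hb⟩ := hexp' J hJ
    exact ⟨C, R, hC, hR, fun z hz hzR =>
      hb z (US_ne hz) ((arg_iff hδ hδ' (US_ne hz)).2 (le_of_lt hz)) hzR⟩
  set u : ℂ := Complex.exp ((δ : ℂ) * Complex.I) with hu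
  set v : ℂ := Complex.exp (-(δ : ℂ) * Complex.I) with hv
  have hbd : ∀ j k : ℕ, s j = -k - 1 → c j u * u ^ (k + 1) = c j v * v ^ (k + 1) := by
    intro j k hjk
    have := hholo j
    rw [hjk] at this
    exact boundary_eq δ hδ hδ' (c j) k (hc j) this
  have hv' : v = Complex.exp (((-δ : ℝ) : ℂ) * Complex.I) := by rw [hv]; push_cast; rfl
  have hcos : 0 < Real.cos δ := Real.cos_pos_of_mem_Ioo ⟨by linarith, hδ'⟩
  have hu1 : ‖u‖ = 1 := Complex.norm_exp_ofReal_mul_I δ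
  have hv1 : ‖v‖ = 1 := by rw [hv']; exact Complex.norm_exp_ofReal_mul_I _
  have hure : u.re = Real.cos δ := Complex.exp_ofReal_mul_I_re δ
  have hvre : v.re = Real.cos δ := by rw [hv', Complex.exp_ofReal_mul_I_re, Real.cos_neg]
  have hu0 : 0 < u.re := by rwa [hure]
  have hv0 : 0 < v.re := by rwa [hvre]
  have huarg : δ ≤ |Complex.arg u| := by
    rw [arg_iff hδ hδ' (Complex.exp_ne_zero _), hu1, hure, one_mul]
  have hvarg : δ ≤ |Complex.arg v| := by
    rw [arg_iff hδ hδ' (Complex.exp_ne_zero _), hv1, hvre, one_mul]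
  obtain ⟨uc, ub, ue⟩ := ray_setup δ F hFc s hs c hexp' u hu1 huarg
  obtain ⟨vc, vb, ve⟩ := ray_setup δ F hFc s hs c hexp' v hv1 hvarg
  refine ⟨fun t ht => ⟨(exp_integrable u hu0 t ht 0 _ uc ub).mul_const u,
    (exp_integrable v hv0 t ht 0 _ vc vb).mul_const v⟩, ?_⟩
  set E : Set ℝ := {e : ℝ | (∃ j : ℕ, e = ((j : ℝ) - (n : ℝ)) / (m : ℝ) + N - 1) ∨ ∃ k : ℕ, e = (k : ℝ)} with hEdef
  have hE : ∀ k : ℕ, (k : ℝ) ∈ E := fun k => Or.inr ⟨k, rfl⟩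
  have hsE : ∀ j, -(s j) - 1 ∈ E := fun j => Or.inl ⟨j, by simp only [hsdef]; ring⟩
  refine exists_alpha (E := E) (G := fun t => (1 / (2 * (Real.pi : ℂ) * Complex.I)) *
            ((∫ r in Set.Ioi (0 : ℝ),
                Complex.exp (-(t : ℂ) * (r : ℂ) * u) * F ((r : ℂ) * u) * u) -
              ∫ r in Set.Ioi (0 : ℝ),
                Complex.exp (-(t : ℂ) * (r : ℂ) * v) * F ((r : ℂ) * v) * v)) fun L => ?_
  obtain ⟨K, hK⟩ := exists_nat_ge L
  obtain ⟨J, hJ⟩ := exists_nat_gt (max 0 ((n:ℝ) + m * (K + 1 - N)))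
  have hJ1 : 1 ≤ J := by
    have : (0:ℝ) < J := (le_max_left _ _).trans_lt hJ
    exact_mod_cast this
  have hJs : s J + K < -1 := by
    have h1 : (n:ℝ) + m * (K + 1 - N) < J := (le_max_right _ _).trans_lt hJ
    simp only [hsdef]
    have : ((n:ℝ) - J) / m < N - K - 1 := by
      rw [div_lt_iff₀ hm0]; nlinarith
    linarith
  have Ru := ray_expansion hE L u hu0 _ uc ub s hs (fun j => c j u) J K hK hJs (ue J hJ1)
  have Rv := ray_expansion hE L v hv0 _ vc vb s hs (fun j => c j v) J K hK hJs (ve J hJ1)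
  set Iu : ℕ → ℝ → ℂ := fun j t => ∫ r in Set.Ioi (1:ℝ), Complex.exp (-(t : ℂ) * (r : ℂ) * u) * pw (s j) r with hIu
  set Iv : ℕ → ℝ → ℂ := fun j t => ∫ r in Set.Ioi (1:ℝ), Complex.exp (-(t : ℂ) * (r : ℂ) * v) * pw (s j) r with hIv
  have hj : ∀ j, (c j u * u) • Iu j - (c j v * v) • Iv j ∈ ML E L := by
    intro j
    by_cases hk : ∃ k : ℕ, s j = -k - 1
    · obtain ⟨k, hk⟩ := hk
      have aux : ∀ w : ℂ, 0 < w.re → (fun t : ℝ => ∫ r in Set.Ioi (1:ℝ),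
          Complex.exp (-(t : ℂ) * (r : ℂ) * w) * pw (s j) r) +
          (fun t : ℝ => (-w) ^ k / (k.factorial : ℂ) * (t : ℂ) ^ k * (Real.log t : ℂ)) ∈ ML E L := by
        intro w hw
        refine I_expansion hE L w hw (s j) (hs j) (hsE j) _ (fun h => absurd hk (h k)) ?_
        intro k' hk'
        have : (k:ℝ) = k' := by linarith
        have : k = k' := by exact_mod_cast this
        rw [this]
      have := Submodule.sub_mem _ (Submodule.smul_mem _ (c j u * u) (aux u hu0))
        (Submodule.smul_mem _ (c j v * v) (aux v hv0))
      convert this using 1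
      funext t
      simp only [Pi.sub_apply, Pi.add_apply, Pi.smul_apply, smul_eq_mul, hIu, hIv]
      rw [neg_pow u, neg_pow v]
      linear_combination (-((-1) ^ k / (k.factorial : ℂ) * (t : ℂ) ^ k * (Real.log t : ℂ))) * hbd j k hk
    · push Not at hk
      have aux : ∀ w : ℂ, 0 < w.re → (fun t : ℝ => ∫ r in Set.Ioi (1:ℝ),
          Complex.exp (-(t : ℂ) * (r : ℂ) * w) * pw (s j) r) ∈ ML E L := by
        intro w hw
        have := I_expansion hE L w hw (s j) (hs j) (hsE j) 0 (fun _ => rfl) (fun k' hk' => absurd hk' (hk k'))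
        rwa [add_zero] at this
      exact Submodule.sub_mem _ (Submodule.smul_mem _ (c j u * u) (aux u hu0))
        (Submodule.smul_mem _ (c j v * v) (aux v hv0))
  have htot := Submodule.smul_mem _ (1 / (2 * (Real.pi : ℂ) * Complex.I)) (Submodule.add_mem _
    (Submodule.sub_mem _ (Submodule.smul_mem _ u Ru) (Submodule.smul_mem _ v Rv))
    (Submodule.sum_mem (ML E L) (t := Finset.range J) fun j _ => hj j))
  convert htot using 1
  funext t
  simp only [Pi.sub_apply, Pi.add_apply, Pi.smul_apply, smul_eq_mul, Finset.sum_apply, integral_mul_const,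
    Finset.sum_sub_distrib, mul_sub, Finset.mul_sum]
  have e1 : ∀ j, u * (c j u * Iu j t) = c j u * u * Iu j t := fun j => by ring
  have e2 : ∀ j, v * (c j v * Iv j t) = c j v * v * Iv j t := fun j => by ring
  simp only [hIu, hIv] at e1 e2
  simp only [hIu, hIv, e1, e2]
  ring
end
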